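/- arXiv:1903.00501 — 14 statements merged into one kernel-verified Lean document; each statement's English description precedes it below -/
import Mathlib

section
/- Let n be a positive integer and let F be a permutation of the finite field GF(2^n). Then for all nonzero a, b in GF(2^n), BCT_F(a,b) = BCT_{F^{-1}}(b,a), where F^{-1} denotes the compositional inverse of F. -/
open scoped Classical

/-- Difference Distribution Table entry: `DDT F a b = #{x | F(x+a) + F(x) = b}`. -/
noncomputable def DDT {K : Type*} [Field K] (F : K → K) (a b : K) : ℕ :=
  Set.ncard {x : K | F (x + a) + F x = b}

/-- Boomerang Connectivity Table entry:
`BCT F a b = #{x | F⁻¹(F(x)+b) + F⁻¹(F(x+a)+b) = a}`, where `F⁻¹` is the compositional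
inverse of the permutation `F` (realized via `Function.invFun`). -/
noncomputable def BCT {K : Type*} [Field K] (F : K → K) (a b : K) : ℕ :=
  haveI : Nonempty K := ⟨0⟩
  Set.ncard {x : K |
    Function.invFun F (F x + b) + Function.invFun F (F (x + a) + b) = a}

/-- Differential uniformity: the maximum of `DDT F a b` over nonzero `a, b`. -/
noncomputable def deltaU {K : Type*} [Field K] [Fintype K] (F : K → K) : ℕ :=
  Finset.sup (Finset.univ.filter fun p : K × K => p.1 ≠ 0 ∧ p.2 ≠ 0)
    fun p => DDT F p.1 p.2

/-- Boomerang uniformity: the maximum of `BCT F a b` over nonzero `a, b`. -/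
noncomputable def betaU {K : Type*} [Field K] [Fintype K] (F : K → K) : ℕ :=
  Finset.sup (Finset.univ.filter fun p : K × K => p.1 ≠ 0 ∧ p.2 ≠ 0)
    fun p => BCT F p.1 p.2

theorem boomerang_inverse_iff {K : Type*} [Field K] [CharP K 2] {F G : K → K}
    (hl : Function.LeftInverse G F) (hr : Function.RightInverse G F) (a b x : K) :
    F (G (F x) + a) + F (G (F x + b) + a) = b ↔ G (F x + b) + G (F (x + a) + b) = a := by
  rw [hl x, add_comm (G (F x + b)) (G _), CharTwo.add_eq_iff_eq_add,
    CharTwo.add_eq_iff_eq_add, add_comm b, add_comm a]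
  constructor
  · intro h
    rw [h, add_assoc, CharTwo.add_self_eq_zero, add_zero, hl]
  · intro h
    rw [← h, hr, add_assoc, CharTwo.add_self_eq_zero, add_zero]

theorem bct_inverse {K : Type*} [Field K] [Fintype K] (n : ℕ) (hn : 0 < n)
    (hcard : Fintype.card K = 2 ^ n) (F : K → K) (hF : Function.Bijective F)
    (a b : K) (ha : a ≠ 0) (hb : b ≠ 0) :
    haveI : Nonempty K := ⟨0⟩
    BCT F a b = BCT (Function.invFun F) b a := by
  have : Nonempty K := ⟨0⟩
  have hl : Function.LeftInverse (Function.invFun F) F := Function.leftInverse_invFun hF.1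
  have hr : Function.RightInverse (Function.invFun F) F := Function.rightInverse_invFun hF.2
  have hGG : Function.invFun (Function.invFun F) = F :=
    (Function.leftInverse_invFun hr.injective).eq_rightInverse hl
  have h2 : (2 : K) = 0 := by
    have h := Nat.cast_card_eq_zero K
    rw [hcard, Nat.cast_pow] at h
    exact_mod_cast eq_zero_of_pow_eq_zero h
  have : CharP K 2 := CharTwo.of_one_ne_zero_of_two_eq_zero one_ne_zero h2
  unfold BCT
  rw [hGG, ← Set.ncard_preimage_of_injective_subset_range (f := F) (s := {y : K | _ = b}) hF.1
    (by rw [hF.2.range_eq]; exact Set.subset_univ _)]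
  congr 1
  ext x
  exact (boomerang_inverse_iff hl hr a b x).symm
end

section
/- Let n be a positive integer and let F be a permutation of GF(2^n). Then the differential uniformity of F equals 2 if and only if the boomerang uniformity of F equals 2, i.e. Δ(F) = 2 if and only if β(F) = 2. -/
open scoped Classical

theorem DDT_le_deltaU {K : Type*} [Field K] [Fintype K] (F : K → K) {a b : K}
    (ha : a ≠ 0) (hb : b ≠ 0) : DDT F a b ≤ deltaU F :=
  Finset.le_sup (f := fun p : K × K => DDT F p.1 p.2) (b := (a, b)) (by simp [ha, hb])

section CharTwo

variable {K : Type*} [Field K] [CharP K 2] {F : K → K}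

theorem add_apply_ne_zero (hF : Function.Injective F) {a : K} (ha : a ≠ 0) (x : K) :
    F (x + a) + F x ≠ 0 := fun h =>
  ha (by simpa using hF (CharTwo.add_eq_zero.mp h))

variable [Fintype K]

/-- The differential equation `F (x + a) + F x = c` is invariant under `x ↦ x + a`, so it has at
least two solutions as soon as it has one. -/
theorem two_le_deltaU (hF : Function.Injective F) : 2 ≤ deltaU F := by
  have hone : (0 : K) ≠ 1 := zero_ne_one
  refine le_trans ?_ (DDT_le_deltaU F one_ne_zero (add_apply_ne_zero hF one_ne_zero 0))
  rw [← Set.ncard_pair hone]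
  refine Set.ncard_le_ncard ?_ (Set.toFinite _)
  rintro x (rfl | rfl)
  · rfl
  · simp [CharTwo.add_self_eq_zero, add_comm]

theorem DDT_le_BCT (hF : Function.Injective F) (a b : K) : DDT F a b ≤ BCT F a b := by
  refine Set.ncard_le_ncard ?_ (Set.toFinite _)
  intro x (hx : F (x + a) + F x = b)
  have h₁ : F x + b = F (x + a) := by
    rw [← hx, add_left_comm, CharTwo.add_self_eq_zero, add_zero]
  have h₂ : F (x + a) + b = F x := by
    rw [← hx, ← add_assoc, CharTwo.add_self_eq_zero, zero_add]
  have hinv := Function.leftInverse_invFun hF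
  change Function.invFun F (F x + b) + Function.invFun F (F (x + a) + b) = a
  rw [h₁, h₂, hinv, hinv, add_right_comm, CharTwo.add_self_eq_zero, zero_add]

/-- If `F` is almost perfect nonlinear, the only solutions of the differential equation satisfied
by `x` in direction `a` are `x` and `x + a`. -/
theorem eq_or_eq_add_of_deltaU_le_two (hF : Function.Injective F) (hd : deltaU F ≤ 2)
    {a x y : K} (ha : a ≠ 0) (h : F (y + a) + F y = F (x + a) + F x) : y = x ∨ y = x + a := by
  by_contra! hne
  have hsub : ({y, x, x + a} : Set K) ⊆ {z | F (z + a) + F z = F (x + a) + F x} := by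
    rintro z (rfl | rfl | rfl)
    · exact h
    · rfl
    · change F (x + a + a) + F (x + a) = F (x + a) + F x
      rw [add_assoc x, CharTwo.add_self_eq_zero, add_zero, add_comm]
  have hcard : ({y, x, x + a} : Set K).ncard = 3 :=
    Set.ncard_eq_three.mpr ⟨y, x, x + a, hne.1, hne.2, by simpa using ha, rfl⟩
  have hle := Set.ncard_le_ncard hsub (Set.toFinite _)
  have hD := DDT_le_deltaU F ha (add_apply_ne_zero hF ha x)
  unfold DDT at hD
  lia

theorem BCT_le_DDT (hF : Function.Bijective F) (hd : deltaU F ≤ 2) {a b : K} (ha : a ≠ 0)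
    (hb : b ≠ 0) : BCT F a b ≤ DDT F a b := by
  refine Set.ncard_le_ncard ?_ (Set.toFinite _)
  intro x (hx : Function.invFun F (F x + b) + Function.invFun F (F (x + a) + b) = a)
  have hinv := Function.rightInverse_invFun hF.2
  set y := Function.invFun F (F x + b) with hy
  have hy₁ : F y = F x + b := hinv _
  have hy₂ : F (y + a) = F (x + a) + b := by
    rw [← hinv (F (x + a) + b)]
    congr 1
    rw [← hx, ← add_assoc, CharTwo.add_self_eq_zero, zero_add, hx]
  have hxy : F (y + a) + F y = F (x + a) + F x := by
    rw [hy₁, hy₂, add_add_add_comm, CharTwo.add_self_eq_zero, add_zero]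
  change F (x + a) + F x = b
  rcases eq_or_eq_add_of_deltaU_le_two hF.1 hd ha hxy with h | h
  · rw [h] at hy₁
    exact absurd (by simpa using hy₁) hb
  · rw [← h, hy₁, add_right_comm, CharTwo.add_self_eq_zero, zero_add]

theorem deltaU_le_betaU (hF : Function.Injective F) : deltaU F ≤ betaU F :=
  Finset.sup_mono_fun fun p _ => DDT_le_BCT hF p.1 p.2

theorem betaU_le_deltaU (hF : Function.Bijective F) (hd : deltaU F ≤ 2) : betaU F ≤ deltaU F :=
  Finset.sup_mono_fun fun p hp => by
    obtain ⟨ha, hb⟩ := (Finset.mem_filter.mp hp).2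
    exact BCT_le_DDT hF hd ha hb

end CharTwo

theorem apn_iff_boomerang_two {K : Type*} [Field K] [Fintype K] (n : ℕ) (hn : 0 < n)
    (hcard : Fintype.card K = 2 ^ n) (F : K → K) (hF : Function.Bijective F) :
    deltaU F = 2 ↔ betaU F = 2 := by
  have : Fact (Nat.Prime 2) := ⟨Nat.prime_two⟩
  have : CharP K 2 := charP_of_card_eq_prime_pow hcard
  have h₁ := two_le_deltaU hF.1
  have h₂ := deltaU_le_betaU hF.1
  constructor
  · intro h
    have h₃ := betaU_le_deltaU hF h.le
    lia
  · intro h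
    lia
end

section
/- Let n be a positive integer and let F be a permutation of GF(2^n). Then for all nonzero a, b in GF(2^n), BCT_F(a,b) equals the number of pairs (x,y) in GF(2^n) × GF(2^n) satisfying F(x) + F(y) = b and F(x+a) + F(y+a) = b simultaneously. -/
open scoped Classical

theorem bct_as_pairs {K : Type*} [Field K] [Fintype K] (n : ℕ) (hn : 0 < n)
    (hcard : Fintype.card K = 2 ^ n) (F : K → K) (hF : Function.Bijective F)
    (a b : K) (ha : a ≠ 0) (hb : b ≠ 0) :
    BCT F a b =
      Set.ncard {p : K × K | F p.1 + F p.2 = b ∧ F (p.1 + a) + F (p.2 + a) = b} := by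
  have h2 : (2 : K) = 0 := by
    have h : ((Fintype.card K : ℕ) : K) = 0 := Nat.cast_card_eq_zero K
    rw [hcard, Nat.cast_pow] at h
    exact_mod_cast eq_zero_of_pow_eq_zero h
  have : Nonempty K := ⟨0⟩
  have hr : ∀ y, F (Function.invFun F y) = y := Function.rightInverse_invFun hF.2
  have hl : ∀ x, Function.invFun F (F x) = x := Function.leftInverse_invFun hF.1
  have invFun_eq_iff : ∀ y x, Function.invFun F y = x ↔ y = F x := fun y x =>
    ⟨fun h => by rw [← h, hr], fun h => by rw [h, hl]⟩
  have add_eq_iff : ∀ u v w : K, u + v = w ↔ v = u + w := fun u v w =>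
    ⟨fun h => by linear_combination h - u * h2, fun h => by linear_combination h + u * h2⟩
  have hinj : Function.Injective fun x : K => (x, Function.invFun F (F x + b)) :=
    fun _ _ h => congrArg Prod.fst h
  rw [BCT, ← Set.ncard_image_of_injective _ hinj]
  congr 1
  ext ⟨x, y⟩
  simp only [Set.mem_image, Set.mem_ofPred_eq, Prod.mk.injEq]
  have key : Function.invFun F (F x + b) = y →
      (Function.invFun F (F x + b) + Function.invFun F (F (x + a) + b) = a ↔
        F (x + a) + F (y + a) = b) := fun h => by
    rw [h, add_eq_iff, invFun_eq_iff, add_eq_iff, eq_comm]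
  constructor
  · rintro ⟨_, h, rfl, hy⟩
    exact ⟨(add_eq_iff _ _ _).2 ((invFun_eq_iff _ _).1 hy).symm, (key hy).1 h⟩
  · rintro ⟨h, h'⟩
    have hy := (invFun_eq_iff _ _).2 ((add_eq_iff _ _ _).1 h).symm
    exact ⟨x, (key hy).2 h', rfl, hy⟩
end

section
/- Let n be a positive integer and let F be a permutation of GF(2^n). Then for all nonzero a, b in GF(2^n), BCT_F(a,b) = Σ_{γ ∈ GF(2^n), γ ≠ 0} #( U^F_{γ,b} ∩ (a + U^F_{γ,b}) ), where U^F_{γ,b} = {x in GF(2^n) : F(x) + F(x+γ) = b} and a + U^F_{γ,b} denotes the translate {a + u : u ∈ U^F_{γ,b}}. -/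
open scoped Classical

/-- In characteristic two, the derivative of `F` at `x` in direction `γ` equals `b` exactly when
`γ = x + F⁻¹(F x + b)`. -/
theorem add_map_add_eq_iff_of_charTwo {K : Type*} [Field K] [CharP K 2] [Nonempty K] {F : K → K}
    (hF : Function.Bijective F) (x γ b : K) :
    F x + F (x + γ) = b ↔ x + Function.invFun F (F x + b) = γ := by
  have h2 : ∀ y : K, y + y = 0 := CharTwo.add_self_eq_zero
  have hr : F (Function.invFun F (F x + b)) = F x + b :=
    Function.rightInverse_invFun hF.surjective _
  constructor
  · intro h
    have h1 : F x + b = F (x + γ) := by linear_combination h2 (F x) - h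
    rw [h1, Function.leftInverse_invFun hF.injective]
    linear_combination h2 x
  · rintro rfl
    have h1 : x + (x + Function.invFun F (F x + b)) = Function.invFun F (F x + b) := by
      linear_combination h2 x
    rw [h1, hr]
    linear_combination h2 (F x)

theorem bct_new_formulation {K : Type*} [Field K] [Fintype K] (n : ℕ) (hn : 0 < n)
    (hcard : Fintype.card K = 2 ^ n) (F : K → K) (hF : Function.Bijective F)
    (a b : K) (ha : a ≠ 0) (hb : b ≠ 0) :
    BCT F a b =
      ∑ γ ∈ Finset.univ.filter (fun γ : K => γ ≠ 0),
        Set.ncard ({x : K | F x + F (x + γ) = b} ∩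
          ((fun u => a + u) '' {x : K | F x + F (x + γ) = b})) := by
  have : CharP K 2 := charP_of_card_eq_prime_pow hcard
  have : Nonempty K := ⟨0⟩
  have h2 : ∀ y : K, y + y = 0 := CharTwo.add_self_eq_zero
  have hU := add_map_add_eq_iff_of_charTwo hF
  set G := Function.invFun F with hG
  have hmem : ∀ x γ : K, x ∈ {x : K | F x + F (x + γ) = b} ∩
      ((fun u => a + u) '' {x : K | F x + F (x + γ) = b}) ↔
      G (F x + b) + G (F (x + a) + b) = a ∧ x + G (F x + b) = γ := by
    intro x γ
    have htr : x ∈ (fun u => a + u) '' {x : K | F x + F (x + γ) = b} ↔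
        F (x + a) + F (x + a + γ) = b := by
      constructor
      · rintro ⟨u, hu, rfl⟩
        have h1 : a + u + a = u := by linear_combination h2 a
        simp only [h1]
        exact hu
      · intro h
        exact ⟨x + a, h, by linear_combination h2 a⟩
    rw [Set.mem_inter_iff, htr, Set.mem_ofPred_eq, hU, hU, and_comm]
    refine and_congr_left fun hγ => ?_
    constructor <;> intro h
    · linear_combination h + hγ - h2 x - h2 a + h2 γ
    · linear_combination h - hγ + h2 x + h2 a - h2 γ
  have hne : ∀ x : K, x + G (F x + b) ≠ 0 := by
    intro x hx
    have h := (hU x 0 b).mpr hx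
    rw [add_zero, h2] at h
    exact hb h.symm
  have hBCT : BCT F a b =
      (Finset.univ.filter fun x : K => G (F x + b) + G (F (x + a) + b) = a).card := by
    rw [← Set.ncard_coe_finset, Finset.coe_filter_univ]
    rfl
  rw [hBCT, Finset.card_eq_sum_card_fiberwise (f := fun x => x + G (F x + b))
    (t := Finset.univ.filter fun γ : K => γ ≠ 0) (fun x _ => by simpa using hne x)]
  refine Finset.sum_congr rfl fun γ _ => ?_
  rw [← Set.ncard_coe_finset]
  congr 1
  ext x
  rw [hmem]
  simp
end

section
/- Let n be a positive integer and let F be a permutation of GF(2^n). Then for all nonzero a, b in GF(2^n), BCT_F(a,b) = DDT_F(a,b) + Σ_{γ ∈ GF(2^n), γ ≠ 0, γ ≠ b} #( U^{F^{-1}}_{γ,a} ∩ (b + U^{F^{-1}}_{γ,a}) ), where U^{F^{-1}}_{γ,a} = {x in GF(2^n) : F^{-1}(x) + F^{-1}(x+γ) = a} and b + U^{F^{-1}}_{γ,a} denotes the translate {b + u : u ∈ U^{F^{-1}}_{γ,a}}. -/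
open scoped Classical

theorem ncard_eq_sum_ncard_fiber {α β : Type*} [Fintype α] [Fintype β] (S : Set α) (f : α → β) :
    S.ncard = ∑ c, {x | x ∈ S ∧ f x = c}.ncard := by
  simp only [Set.ncard_eq_toFinset_card']
  rw [Finset.card_eq_sum_card_fiberwise (f := f) (t := Finset.univ) fun _ _ => Finset.mem_univ _]
  refine Finset.sum_congr rfl fun c _ => congrArg Finset.card ?_
  ext x
  simp

theorem charP_two_of_card_eq_two_pow {K : Type*} [Field K] [Fintype K] {n : ℕ}
    (hcard : Fintype.card K = 2 ^ n) : CharP K 2 := by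
  have h : ((2 ^ n : ℕ) : K) = 0 := hcard ▸ Nat.cast_card_eq_zero K
  push_cast at h
  exact CharTwo.of_one_ne_zero_of_two_eq_zero one_ne_zero (eq_zero_of_pow_eq_zero h)

section CharTwo

variable {K : Type*} [Field K] [CharP K 2]

/-- In characteristic two, `F x` lies in `U_{γ,a}` of the inverse `G` of `F` iff the derivative of `F`
in direction `a` takes the value `γ` at `x`. -/
theorem add_apply_add_eq_iff {F G : K → K} (hl : Function.LeftInverse G F)
    (hr : Function.RightInverse G F) (a γ x : K) :
    G (F x) + G (F x + γ) = a ↔ F x + F (x + a) = γ := by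
  have hx : ∀ {u v w : K}, u + v = w ↔ v = u + w := fun {u v w} => by
    rw [add_comm u v, CharTwo.add_eq_iff_eq_add, add_comm u w]
  rw [hl x, hx, hx]
  constructor
  · intro h
    rw [← h, hr]
  · intro h
    rw [← h, hl]

theorem boomerang_fiber_zero {F : K → K} (hF : Function.Injective F) (G : K → K) {a b : K}
    (ha : a ≠ 0) :
    {x | x ∈ {x | G (F x + b) + G (F (x + a) + b) = a} ∧ F x + F (x + a) = 0} = ∅ := by
  ext x
  simp only [Set.mem_ofPred_eq, Set.mem_empty_iff_false, iff_false, not_and]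
  intro _ h
  exact ha (left_eq_add.1 (hF (CharTwo.add_eq_zero.1 h)))

theorem boomerang_fiber_self {F G : K → K} (hl : Function.LeftInverse G F) {a b : K} :
    {x | x ∈ {x | G (F x + b) + G (F (x + a) + b) = a} ∧ F x + F (x + a) = b} =
      {x | F (x + a) + F x = b} := by
  ext x
  simp only [Set.mem_ofPred_eq, add_comm (F (x + a)) (F x), and_iff_right_iff_imp]
  rintro rfl
  rw [CharTwo.add_cancel_left, add_comm (F x), CharTwo.add_cancel_left, hl, hl, add_right_comm,
    CharTwo.add_self_eq_zero, zero_add]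

theorem ncard_boomerang_fiber {F G : K → K} (hl : Function.LeftInverse G F)
    (hr : Function.RightInverse G F) (a b γ : K) :
    {x | x ∈ {x | G (F x + b) + G (F (x + a) + b) = a} ∧ F x + F (x + a) = γ}.ncard =
      ({y | G y + G (y + γ) = a} ∩ ((fun u => b + u) '' {y | G y + G (y + γ) = a})).ncard := by
  rw [← Set.ncard_image_of_injective _ hl.injective]
  congr 1
  ext y
  obtain ⟨x, rfl⟩ := hr.surjective y
  have htrans : F x ∈ (fun u => b + u) '' {y | G y + G (y + γ) = a} ↔
      G (F x + b) + G (F x + b + γ) = a := by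
    constructor
    · rintro ⟨u, hu, h : b + u = F x⟩
      rwa [← h, add_comm b u, CharTwo.add_cancel_right]
    · intro h
      exact ⟨F x + b, h, by simp only [add_comm (F x) b, CharTwo.add_cancel_left]⟩
  rw [hl.injective.mem_set_image, Set.mem_inter_iff, htrans]
  simp only [Set.mem_ofPred_eq, add_apply_add_eq_iff hl hr, and_comm (b := _ = γ)]
  refine and_congr_right ?_
  rintro rfl
  rw [add_right_comm, CharTwo.add_cancel_left]

end CharTwo

theorem bct_boura_canteaut {K : Type*} [Field K] [Fintype K] (n : ℕ) (hn : 0 < n)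
    (hcard : Fintype.card K = 2 ^ n) (F : K → K) (hF : Function.Bijective F)
    (a b : K) (ha : a ≠ 0) (hb : b ≠ 0) :
    haveI : Nonempty K := ⟨0⟩
    BCT F a b = DDT F a b +
      ∑ γ ∈ Finset.univ.filter (fun γ : K => γ ≠ 0 ∧ γ ≠ b),
        Set.ncard ({x : K | Function.invFun F x + Function.invFun F (x + γ) = a} ∩
          ((fun u => b + u) ''
            {x : K | Function.invFun F x + Function.invFun F (x + γ) = a})) := by
  have : Nonempty K := ⟨0⟩
  have : CharP K 2 := charP_two_of_card_eq_two_pow hcard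
  have hl : Function.LeftInverse (Function.invFun F) F := Function.leftInverse_invFun hF.1
  have hr : Function.RightInverse (Function.invFun F) F := Function.rightInverse_invFun hF.2
  have hfilter : Finset.univ.filter (fun γ : K => γ ≠ 0 ∧ γ ≠ b) =
      (Finset.univ.erase 0).erase b := by
    ext γ
    simp [and_comm]
  unfold BCT DDT
  rw [ncard_eq_sum_ncard_fiber _ fun x => F x + F (x + a), hfilter,
    ← Finset.add_sum_erase _ _ (Finset.mem_univ (0 : K)),
    ← Finset.add_sum_erase _ _ (Finset.mem_erase.2 ⟨hb, Finset.mem_univ b⟩)]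
  rw [boomerang_fiber_zero hF.1 _ ha, boomerang_fiber_self hl, Set.ncard_empty, zero_add]
  exact congrArg _ (Finset.sum_congr rfl fun γ _ => ncard_boomerang_fiber hl hr a b γ)
end

section
/- Let n be a positive integer and let F be a permutation of GF(2^n). Then for all nonzero a, b in GF(2^n), BCT_F(a,b) = DDT_F(a,b) + Σ_{γ ∈ GF(2^n), γ ≠ 0, γ ≠ a} #( U^F_{γ,b} ∩ (a + U^F_{γ,b}) ), where U^F_{γ,b} = {x in GF(2^n) : F(x) + F(x+γ) = b} and a + U^F_{γ,b} denotes the translate {a + u : u ∈ U^F_{γ,b}}. -/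
open scoped Classical

/-- For a permutation `F` in characteristic two, the boomerang condition at `x` says that the
derivatives at `x` and `x + a` take the value `b` in a common direction `γ`. -/
theorem boomerang_iff_exists_direction {K : Type*} [Field K] [CharP K 2] [Nonempty K]
    {F : K → K} (hF : Function.Bijective F) (a b x : K) :
    Function.invFun F (F x + b) + Function.invFun F (F (x + a) + b) = a ↔
      F x + F (x + (x + Function.invFun F (F x + b))) = b ∧
        F (x + a) + F (x + a + (x + Function.invFun F (F x + b))) = b := by
  have hr : ∀ y, F (Function.invFun F y) = y := Function.rightInverse_invFun hF.surjective
  have hl : ∀ y, Function.invFun F (F y) = y := Function.leftInverse_invFun hF.injective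
  have h2 : (2 : K) = 0 := CharTwo.two_eq_zero
  set u := Function.invFun F (F x + b)
  have e1 : x + (x + u) = u := by linear_combination x * h2
  have e2 : x + a + (x + u) = u + a := by linear_combination x * h2
  rw [e1, e2, hr]
  constructor
  · intro h
    have h' : Function.invFun F (F (x + a) + b) = u + a := by
      linear_combination h - u * h2
    refine ⟨by linear_combination F x * h2, ?_⟩
    rw [← h', hr]
    linear_combination F (x + a) * h2
  · rintro ⟨-, h⟩
    have h' : F (x + a) + b = F (u + a) := by linear_combination F (x + a) * h2 - h
    rw [h', hl]
    linear_combination u * h2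

/-- The direction `γ` with `F x + F (x + γ) = b` is unique when `F` is a permutation. -/
theorem direction_eq {K : Type*} [Field K] [CharP K 2] [Nonempty K]
    {F : K → K} (hF : Function.Bijective F) {b x γ : K} (h : F x + F (x + γ) = b) :
    x + Function.invFun F (F x + b) = γ := by
  have h2 : (2 : K) = 0 := CharTwo.two_eq_zero
  have h' : F x + b = F (x + γ) := by linear_combination F x * h2 - h
  rw [h', Function.leftInverse_invFun hF.injective]
  linear_combination x * h2

/-- In characteristic two, membership in the translate `a + U` is membership of `x + a` in `U`. -/
theorem mem_inter_translate_iff {K : Type*} [Field K] [CharP K 2] (F : K → K) (a b γ x : K) :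
    x ∈ {x : K | F x + F (x + γ) = b} ∩ ((fun u => a + u) '' {x : K | F x + F (x + γ) = b}) ↔
      F x + F (x + γ) = b ∧ F (x + a) + F (x + a + γ) = b := by
  have h2 : (2 : K) = 0 := CharTwo.two_eq_zero
  simp only [Set.mem_inter_iff, Set.mem_ofPred_eq, Set.mem_image]
  refine and_congr_right fun _ => ⟨?_, fun h => ⟨x + a, h, by linear_combination a * h2⟩⟩
  rintro ⟨u, hu, rfl⟩
  have e : a + u + a = u := by linear_combination a * h2
  rwa [e]

/-- The boomerang count is the sum over all directions `γ` of the sizes of `U ∩ (a + U)`. -/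
theorem BCT_eq_sum {K : Type*} [Field K] [Fintype K] [CharP K 2] {F : K → K}
    (hF : Function.Bijective F) (a b : K) :
    BCT F a b = ∑ γ : K, Set.ncard ({x : K | F x + F (x + γ) = b} ∩
      ((fun u => a + u) '' {x : K | F x + F (x + γ) = b})) := by
  have : Nonempty K := ⟨0⟩
  unfold BCT
  rw [Set.ncard_eq_toFinset_card', Finset.card_eq_sum_card_fiberwise
    (f := fun x => x + Function.invFun F (F x + b)) (t := Finset.univ) (by simp)]
  refine Finset.sum_congr rfl fun γ _ => ?_
  rw [← Set.ncard_coe_finset]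
  congr 1
  ext x
  rw [mem_inter_translate_iff]
  simp only [Finset.coe_filter, Set.mem_toFinset, Set.mem_ofPred_eq,
    boomerang_iff_exists_direction hF]
  constructor
  · rintro ⟨h, rfl⟩
    exact h
  · intro h
    have hγ := direction_eq hF h.1
    exact ⟨by rwa [hγ], hγ⟩

theorem bct_ddt_plus_rest {K : Type*} [Field K] [Fintype K] (n : ℕ) (hn : 0 < n)
    (hcard : Fintype.card K = 2 ^ n) (F : K → K) (hF : Function.Bijective F)
    (a b : K) (ha : a ≠ 0) (hb : b ≠ 0) :
    BCT F a b = DDT F a b +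
      ∑ γ ∈ Finset.univ.filter (fun γ : K => γ ≠ 0 ∧ γ ≠ a),
        Set.ncard ({x : K | F x + F (x + γ) = b} ∩
          ((fun u => a + u) '' {x : K | F x + F (x + γ) = b})) := by
  have : CharP K 2 := by
    have := Fact.mk Nat.prime_two
    exact charP_of_card_eq_prime_pow hcard
  have h2 : (2 : K) = 0 := CharTwo.two_eq_zero
  rw [BCT_eq_sum hF, ← Finset.sum_filter_add_sum_filter_not _ (fun γ : K => γ ≠ 0 ∧ γ ≠ a),
    add_comm]
  congr 1
  have hs : Finset.univ.filter (fun γ : K => ¬(γ ≠ 0 ∧ γ ≠ a)) = {0, a} := by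
    ext γ
    simp only [Finset.mem_filter, Finset.mem_univ, true_and, Finset.mem_insert,
      Finset.mem_singleton]
    tauto
  rw [hs, Finset.sum_pair ha.symm]
  have h0 : {x : K | F x + F (x + 0) = b} = ∅ := by
    ext x
    simp [CharTwo.add_self_eq_zero, hb.symm]
  rw [h0, Set.empty_inter, Set.ncard_empty, zero_add]
  unfold DDT
  congr 1
  ext x
  rw [mem_inter_translate_iff]
  have e : x + a + a = x := by linear_combination a * h2
  rw [e, add_comm (F x), and_self, Set.mem_ofPred_eq]
end

section
/- Let n be a positive integer and let F be a permutation of GF(2^n). Then for any nonzero a in GF(2^n), Σ_{c ∈ GF(2^n), c ≠ 0} BCT_F(a,c) = Σ_{c ∈ GF(2^n), c ≠ 0} #{x in GF(2^n) : F(x+a+c) + F(x+a) + F(x+c) + F(x) = 0}. -/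
open scoped Classical

theorem sum_ncard_setOf_comm {ι α : Type*} [Fintype α] (s : Finset ι) (p : ι → α → Prop) :
    ∑ c ∈ s, Set.ncard {x : α | p c x} = ∑ x : α, (s.filter fun c => p c x).card := by
  simp only [Set.ncard_eq_toFinset_card', Set.toFinset_ofPred, Finset.card_filter]
  exact Finset.sum_comm

theorem bct_row_sum_second_derivative {K : Type*} [Field K] [Fintype K] (n : ℕ) (hn : 0 < n)
    (hcard : Fintype.card K = 2 ^ n) (F : K → K) (hF : Function.Bijective F)
    (a : K) (ha : a ≠ 0) :
    ∑ c ∈ Finset.univ.filter (fun c : K => c ≠ 0), BCT F a c =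
      ∑ c ∈ Finset.univ.filter (fun c : K => c ≠ 0),
        Set.ncard {x : K | F (x + a + c) + F (x + a) + F (x + c) + F x = 0} := by
  have : CharP K 2 := charP_of_card_eq_prime_pow hcard
  have hinv (y z : K) : Function.invFun F y = z ↔ y = F z := by
    constructor
    · rintro rfl
      exact (Function.invFun_eq (hF.2 y)).symm
    · rintro rfl
      exact Function.leftInverse_invFun hF.1 z
  have hboom (x c : K) :
      Function.invFun F (F x + (F x + F (x + c))) +
          Function.invFun F (F (x + a) + (F x + F (x + c))) = a ↔
        F (x + a + c) + F (x + a) + F (x + c) + F x = 0 := by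
    rw [← add_assoc (F x), CharTwo.add_self_eq_zero, zero_add,
      Function.leftInverse_invFun hF.1 (x + c), add_comm (x + c), CharTwo.add_eq_iff_eq_add,
      hinv, show a + (x + c) = x + a + c by ring, ← CharTwo.add_eq_zero]
    ring_nf
  unfold BCT
  rw [sum_ncard_setOf_comm, sum_ncard_setOf_comm]
  refine Finset.sum_congr rfl fun x _ => (Finset.card_bij (fun c _ => F x + F (x + c)) ?_ ?_ ?_).symm
  · intro c hc
    simp only [Finset.mem_filter, Finset.mem_univ, true_and] at hc ⊢
    refine ⟨fun h => hc.1 ?_, (hboom x c).2 hc.2⟩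
    simpa using hF.1 (CharTwo.add_eq_zero.1 h)
  · intro c _ d _ h
    exact add_left_cancel (hF.1 (add_left_cancel h))
  · intro b hb
    obtain ⟨y, hy⟩ := hF.2 (F x + b)
    have hb' : F x + F (x + (x + y)) = b := by
      rw [CharTwo.add_cancel_left, hy, CharTwo.add_cancel_left]
    simp only [Finset.mem_filter, Finset.mem_univ, true_and] at hb
    refine ⟨x + y, ?_, hb'⟩
    simp only [Finset.mem_filter, Finset.mem_univ, true_and]
    refine ⟨fun h => hb.1 ?_, (hboom x (x + y)).1 (by rw [hb']; exact hb.2)⟩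
    rw [← hb', h, add_zero, CharTwo.add_self_eq_zero]
end

section
/- Let n be a positive integer and let F be a permutation of GF(2^n). Then for any nonzero a in GF(2^n), Σ_{c ∈ GF(2^n), c ≠ 0} BCT_F(a,c) = ( Σ_{c ∈ GF(2^n), c ≠ 0} DDT_F(a,c)^2 ) − 2^n. -/
open scoped Classical

theorem DDT_eq_card_filter {K : Type*} [Field K] [Fintype K] (F : K → K) (a b : K) :
    DDT F a b = (Finset.univ.filter fun x => F (x + a) + F x = b).card := by
  rw [DDT, ← Set.ncard_coe_finset]
  simp

theorem DDT_zero_right {K : Type*} [Field K] [CharP K 2] {F : K → K}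
    (hF : Function.Injective F) {a : K} (ha : a ≠ 0) : DDT F a 0 = 0 := by
  have h : {x : K | F (x + a) + F x = 0} = ∅ := by
    ext x
    simp [CharTwo.add_eq_zero, hF.eq_iff, ha]
  rw [DDT, h, Set.ncard_empty]

theorem BCT_zero_right {K : Type*} [Field K] [Fintype K] [CharP K 2] {F : K → K}
    (hF : Function.Injective F) (a : K) : BCT F a 0 = Fintype.card K := by
  have h (x : K) : x + (x + a) = a := by rw [← add_assoc, CharTwo.add_self_eq_zero, zero_add]
  simp [BCT, Function.leftInverse_invFun hF _, h, Nat.card_eq_fintype_card]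

/-- The boomerang condition at `x` says that the derivative of `F` in direction `a` takes the
same value at `x` and at the preimage of `F x + b`. -/
theorem invFun_add_invFun_eq_iff {K : Type*} [Field K] [CharP K 2] [Nonempty K] {F : K → K}
    (hF : Function.Bijective F) (a b x : K) :
    Function.invFun F (F x + b) + Function.invFun F (F (x + a) + b) = a ↔
      F (Function.invFun F (F x + b) + a) + F (Function.invFun F (F x + b)) =
        F (x + a) + F x := by
  have hr := Function.rightInverse_invFun hF.2
  have hy := hr (F x + b)
  have hz := hr (F (x + a) + b)
  generalize Function.invFun F (F x + b) = y at *
  generalize Function.invFun F (F (x + a) + b) = z at *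
  have h2 : (2 : K) = 0 := CharTwo.two_eq_zero
  have h : y + z = a ↔ y + a = z := by
    constructor <;> intro h <;> grind
  rw [h, ← hF.1.eq_iff, hy, hz]
  constructor <;> intro h <;> grind

theorem sum_BCT {K : Type*} [Field K] [Fintype K] [CharP K 2] {F : K → K}
    (hF : Function.Bijective F) (a : K) : ∑ c, BCT F a c = ∑ c, DDT F a c ^ 2 := by
  have hB (c : K) : BCT F a c = ∑ x, if F (Function.invFun F (F x + c) + a) +
      F (Function.invFun F (F x + c)) = F (x + a) + F x then 1 else 0 := by
    rw [BCT, Finset.sum_boole, Nat.cast_id, ← Set.ncard_coe_finset]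
    simp [invFun_add_invFun_eq_iff hF]
  have hinv : Function.Bijective (Function.invFun F) :=
    ⟨(Function.rightInverse_invFun hF.2).injective, Function.invFun_surjective hF.1⟩
  have hx (x : K) : (∑ c, if F (Function.invFun F (F x + c) + a) +
      F (Function.invFun F (F x + c)) = F (x + a) + F x then 1 else 0) =
      DDT F a (F (x + a) + F x) := by
    rw [DDT_eq_card_filter, Finset.card_filter]
    exact (hinv.comp (AddGroup.addLeft_bijective (F x))).sum_comp
      fun y => if F (y + a) + F y = F (x + a) + F x then 1 else 0
  simp_rw [hB]
  rw [Finset.sum_comm, Finset.sum_congr rfl fun x _ => hx x,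
    ← Finset.sum_fiberwise Finset.univ fun x => F (x + a) + F x]
  refine Finset.sum_congr rfl fun c _ => ?_
  rw [Finset.sum_congr rfl fun x hx => by rw [(Finset.mem_filter.1 hx).2], Finset.sum_const,
    ← DDT_eq_card_filter, smul_eq_mul, sq]

theorem bct_row_sum_ddt_squares {K : Type*} [Field K] [Fintype K] (n : ℕ) (hn : 0 < n)
    (hcard : Fintype.card K = 2 ^ n) (F : K → K) (hF : Function.Bijective F)
    (a : K) (ha : a ≠ 0) :
    (∑ c ∈ Finset.univ.filter (fun c : K => c ≠ 0), (BCT F a c : ℤ)) =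
      (∑ c ∈ Finset.univ.filter (fun c : K => c ≠ 0), (DDT F a c : ℤ) ^ 2) - 2 ^ n := by
  have : Fact (Nat.Prime 2) := ⟨Nat.prime_two⟩
  have : CharP K 2 := charP_of_card_eq_prime_pow hcard
  have h := sum_BCT hF a
  rw [← Finset.add_sum_erase _ _ (Finset.mem_univ (0 : K)),
    ← Finset.add_sum_erase _ (fun c => DDT F a c ^ 2) (Finset.mem_univ (0 : K)),
    BCT_zero_right hF.1, DDT_zero_right hF.1 ha, hcard] at h
  rw [Finset.filter_ne' Finset.univ (0 : K)]
  zify at h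
  linarith
end

section
/- Let n be a positive integer and let F be a permutation of GF(2^n). Then for any nonzero b in GF(2^n), Σ_{c ∈ GF(2^n), c ≠ 0} BCT_F(c,b) = Σ_{c ∈ GF(2^n), c ≠ 0} #{x in GF(2^n) : F^{-1}(x+b+c) + F^{-1}(x+b) + F^{-1}(x+c) + F^{-1}(x) = 0}, where F^{-1} denotes the compositional inverse of F. -/
open scoped Classical

/-- A sum over `c ≠ 0` of cardinalities of fibres counts the pairs in the total set. -/
theorem sum_ncard_ne_zero_eq_card {K : Type*} [Zero K] [Fintype K] (P : K → K → Prop) :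
    ∑ c ∈ Finset.univ.filter (fun c : K => c ≠ 0), Set.ncard {x : K | P c x} =
      (Finset.univ.filter fun p : K × K => p.1 ≠ 0 ∧ P p.1 p.2).card := by
  simp only [Finset.card_filter, Fintype.sum_prod_type, Finset.sum_filter]
  refine Finset.sum_congr rfl fun c _ => ?_
  by_cases hc : c = 0
  · simp [hc]
  · simp [hc, Set.ncard_eq_toFinset_card']

theorem bct_column_sum_second_derivative {K : Type*} [Field K] [Fintype K] (n : ℕ)
    (hn : 0 < n) (hcard : Fintype.card K = 2 ^ n) (F : K → K)
    (hF : Function.Bijective F) (b : K) (hb : b ≠ 0) :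
    haveI : Nonempty K := ⟨0⟩
    ∑ c ∈ Finset.univ.filter (fun c : K => c ≠ 0), BCT F c b =
      ∑ c ∈ Finset.univ.filter (fun c : K => c ≠ 0),
        Set.ncard {x : K | Function.invFun F (x + b + c) + Function.invFun F (x + b) +
          Function.invFun F (x + c) + Function.invFun F x = 0} := by
  have hdvd : ringChar K ∣ 2 := by
    obtain ⟨k, hp, hk⟩ := FiniteField.card K (ringChar K)
    exact hp.dvd_of_dvd_pow (hcard ▸ hk ▸ dvd_pow_self _ k.ne_zero)
  have h2 : (2 : K) = 0 := by
    exact_mod_cast (ringChar.spec K 2).2 hdvd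
  have : Nonempty K := ⟨0⟩
  have hGF : ∀ x, Function.invFun F (F x) = x := Function.leftInverse_invFun hF.injective
  have hFG : ∀ x, F (Function.invFun F x) = x := Function.rightInverse_invFun hF.surjective
  unfold BCT
  rw [sum_ncard_ne_zero_eq_card, sum_ncard_ne_zero_eq_card]
  generalize Function.invFun F = G at *
  have hadd : ∀ x y : K, x + (x + y) = y := fun x y => by linear_combination x * h2
  have heq : ∀ x y : K, x + y = 0 → x = y := fun x y h => by linear_combination h - y * h2
  refine Finset.card_nbij' (fun p => (F p.2 + F (p.2 + p.1), F p.2))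
    (fun p => (G p.2 + G (p.2 + p.1), G p.2)) ?_ ?_ ?_ ?_
  · rintro ⟨c, x⟩ h
    simp only [Finset.coe_filter, Finset.mem_univ, true_and, Set.mem_ofPred_eq] at h ⊢
    refine ⟨fun h0 => h.1 ?_, ?_⟩
    · simpa using hF.injective (heq _ _ h0)
    · have e : F x + b + (F x + F (x + c)) = F (x + c) + b := by linear_combination F x * h2
      rw [e, hadd, hGF, hGF]
      linear_combination h.2 + (x + c) * h2
  · rintro ⟨c, u⟩ h
    simp only [Finset.coe_filter, Finset.mem_univ, true_and, Set.mem_ofPred_eq] at h ⊢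
    refine ⟨fun h0 => h.1 ?_, ?_⟩
    · simpa [hFG] using congrArg F (heq _ _ h0)
    · have e : u + c + b = u + b + c := by ring
      rw [hadd, hFG, hFG, e]
      linear_combination h.2 - (G u + G (u + c)) * h2
  · rintro ⟨c, x⟩ _
    simp [hGF, hadd]
  · rintro ⟨c, u⟩ _
    simp [hFG, hadd]
end

section
/- Let n be a positive integer and let F be a permutation of GF(2^n). Then for any nonzero b in GF(2^n), Σ_{c ∈ GF(2^n), c ≠ 0} BCT_F(c,b) = ( Σ_{c ∈ GF(2^n), c ≠ 0} DDT_F(c,b)^2 ) − 2^n. -/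
open scoped Classical

/-- The second moment of the fibre sizes of `s` counts the pairs `(c, x)` with
`s (x + c) = s x`. -/
theorem sum_card_filter_translate_eq_sum_sq {K : Type*} [AddGroup K] [Fintype K] (s : K → K) :
    ∑ c : K, (Finset.univ.filter fun x => s (x + c) = s x).card =
      ∑ c : K, (Finset.univ.filter fun x => s x = c).card ^ 2 := by
  have fiber (x : K) : (Finset.univ.filter fun c => s (x + c) = s x).card =
      (Finset.univ.filter fun y => s y = s x).card :=
    Finset.card_equiv (Equiv.addLeft x) (by simp)
  calc
    _ = ∑ x : K, (Finset.univ.filter fun c => s (x + c) = s x).card := by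
      simp only [Finset.card_filter]
      exact Finset.sum_comm
    _ = ∑ x : K, (Finset.univ.filter fun y => s y = s x).card :=
      Finset.sum_congr rfl fun x _ => fiber x
    _ = ∑ c : K, ∑ x ∈ Finset.univ.filter (fun x => s x = c),
          (Finset.univ.filter fun y => s y = s x).card :=
      (Finset.sum_fiberwise _ _ _).symm
    _ = _ := by
      refine Finset.sum_congr rfl fun c _ => ?_
      rw [Finset.sum_congr rfl (g := fun _ => (Finset.univ.filter fun y => s y = c).card)]
      · simp [sq]
      · intro x hx
        simp only [(Finset.mem_filter.mp hx).2]

theorem DDT_zero_left {K : Type*} [Field K] [CharP K 2] (F : K → K) {b : K} (hb : b ≠ 0) :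
    DDT F 0 b = 0 := by
  simp [DDT, CharTwo.add_self_eq_zero, hb.symm]

theorem BCT_zero_left {K : Type*} [Field K] [Fintype K] [CharP K 2] (F : K → K) (b : K) :
    BCT F 0 b = Fintype.card K := by
  simp [BCT, CharTwo.add_self_eq_zero, Set.ncard_univ]

theorem DDT_eq_card_fiber {K : Type*} [Field K] [Fintype K] [CharP K 2] {F : K → K}
    (hF : Function.Bijective F) (c b : K) :
    DDT F c b = (Finset.univ.filter fun x => Function.invFun F (F x + b) + x = c).card := by
  rw [DDT, ← Set.ncard_coe_finset]
  congr 1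
  ext x
  simp only [Set.mem_ofPred_eq, Finset.coe_filter, Finset.mem_univ, true_and]
  have hr := Function.rightInverse_invFun hF.surjective (F x + b)
  rw [CharTwo.add_eq_iff_eq_add, CharTwo.add_eq_iff_eq_add,
    ← hF.injective.eq_iff (a := Function.invFun F (F x + b)), hr, add_comm c x, add_comm b, eq_comm]

theorem BCT_eq_card_translate {K : Type*} [Field K] [Fintype K] [CharP K 2] (F : K → K)
    (c b : K) :
    BCT F c b = (Finset.univ.filter fun x =>
      Function.invFun F (F (x + c) + b) + (x + c) = Function.invFun F (F x + b) + x).card := by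
  rw [BCT, ← Set.ncard_coe_finset]
  congr 1
  ext x
  simp only [Set.mem_ofPred_eq, Finset.coe_filter, Finset.mem_univ, true_and]
  have h2 : (2 : K) = 0 := CharTwo.two_eq_zero
  rw [← CharTwo.add_eq_zero, ← CharTwo.add_eq_zero (b := Function.invFun F (F x + b) + x)]
  constructor <;> intro h
  · linear_combination h + x * h2
  · linear_combination h - x * h2

theorem bct_column_sum_ddt_squares {K : Type*} [Field K] [Fintype K] (n : ℕ) (hn : 0 < n)
    (hcard : Fintype.card K = 2 ^ n) (F : K → K) (hF : Function.Bijective F)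
    (b : K) (hb : b ≠ 0) :
    (∑ c ∈ Finset.univ.filter (fun c : K => c ≠ 0), (BCT F c b : ℤ)) =
      (∑ c ∈ Finset.univ.filter (fun c : K => c ≠ 0), (DDT F c b : ℤ) ^ 2) - 2 ^ n := by
  have : CharP K 2 := charP_of_card_eq_prime_pow hcard
  have h : ∑ c : K, BCT F c b = ∑ c : K, DDT F c b ^ 2 := by
    simp only [BCT_eq_card_translate, DDT_eq_card_fiber hF]
    exact sum_card_filter_translate_eq_sum_sq fun x => Function.invFun F (F x + b) + x
  rw [← Finset.add_sum_erase _ _ (Finset.mem_univ 0),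
    ← Finset.add_sum_erase _ (fun c => DDT F c b ^ 2) (Finset.mem_univ 0),
    BCT_zero_left, DDT_zero_left F hb, hcard] at h
  rw [Finset.filter_ne']
  zify at h
  linarith
end

section
/- Let q = 2^e (e ≥ 1) be a power of 2 and m a positive integer. Let F : GF(q^m) → GF(q^m) be a function of the form F(x) = Σ_{0 ≤ i ≤ j ≤ m−1} c_{ij} x^{q^i + q^j} with coefficients c_{ij} ∈ GF(q^m). If F is a permutation of GF(q^m) and Δ(F) = q, then the boomerang uniformity of F satisfies β(F) = q. -/
open scoped Classical

/-- A finite field with `q ^ m` elements contains at least `q` solutions of `x ^ q = x`. -/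
theorem le_ncard_pow_eq_self {K : Type*} [Field K] [Fintype K] {q m : ℕ} (hq : 2 ≤ q)
    (hcard : Fintype.card K = q ^ m) : q ≤ Set.ncard {x : K | x ^ q = x} := by
  have hd : q - 1 ∣ Nat.card Kˣ := by
    rw [Nat.card_eq_fintype_card, Fintype.card_units, hcard]
    simpa using Nat.sub_dvd_pow_sub_pow q 1 m
  obtain ⟨g, hg⟩ := IsCyclic.exists_ofOrder_eq_natCard (α := Kˣ)
  obtain ⟨k, hk⟩ := hd
  have hpos : 0 < Nat.card Kˣ := Nat.card_pos
  have hk0 : k ≠ 0 := by rintro rfl; simp at hk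
  have hζ : orderOf (g ^ k) = q - 1 := by
    rw [orderOf_pow_of_dvd hk0 (by rw [hg, hk]; exact dvd_mul_left _ _), hg, hk]
    exact Nat.mul_div_cancel _ (Nat.pos_of_ne_zero hk0)
  have hroots : Set.ncard ((fun u : Kˣ => (u : K)) '' (Subgroup.zpowers (g ^ k) : Set Kˣ))
      = q - 1 := by
    rw [Set.ncard_image_of_injective _ Units.val_injective, ← Nat.card_coe_set_eq]
    exact (Nat.card_zpowers _).trans hζ
  have h0 : (0 : K) ∉ (fun u : Kˣ => (u : K)) '' (Subgroup.zpowers (g ^ k) : Set Kˣ) := by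
    rintro ⟨u, -, hu⟩
    exact u.ne_zero hu
  have hins := Set.ncard_insert_of_notMem h0 (Set.toFinite _)
  rw [hroots, Nat.sub_add_cancel (by omega)] at hins
  refine hins.symm.le.trans (Set.ncard_le_ncard ?_ (Set.toFinite _))
  rintro x (rfl | ⟨u, hu, rfl⟩)
  · simp; omega
  · have hu1 : u ^ (q - 1) = 1 := by
      rw [← hζ]
      exact orderOf_dvd_iff_pow_eq_one.1 (orderOf_dvd_of_mem_zpowers hu)
    have : u ^ q = u := by
      conv_lhs => rw [← Nat.sub_add_cancel (show 1 ≤ q by omega), pow_succ, hu1, one_mul]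
    simpa using congrArg Units.val this

/-- The polar form of a Dembowski–Ostrom polynomial with exponents `q ^ i + q ^ j`. -/
noncomputable def polarForm {K : Type*} [Field K] {m : ℕ} (q : ℕ) (c : Fin m → Fin m → K)
    (x y : K) : K :=
  ∑ ij ∈ Finset.univ.filter (fun ij : Fin m × Fin m => ij.1 ≤ ij.2),
    c ij.1 ij.2 * (x ^ q ^ (ij.1 : ℕ) * y ^ q ^ (ij.2 : ℕ) + y ^ q ^ (ij.1 : ℕ) * x ^ q ^ (ij.2 : ℕ))

section PolarForm

variable {K : Type*} [Field K] {e m q : ℕ}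

theorem add_pow_pow_of_charTwo [CharP K 2] (hq : q = 2 ^ e) (x y : K) (i : ℕ) :
    (x + y) ^ q ^ i = x ^ q ^ i + y ^ q ^ i := by
  rw [hq, ← pow_mul]
  exact add_pow_char_pow x y 2 (e * i)

theorem pow_pow_eq_self_of_pow_eq_self {l : K} (hl : l ^ q = l) (i : ℕ) : l ^ q ^ i = l := by
  induction i with
  | zero => simp
  | succ i ih => rw [pow_succ, pow_mul, ih, hl]

theorem polarForm_add_left [CharP K 2] (hq : q = 2 ^ e) (c : Fin m → Fin m → K) (x y a : K) :
    polarForm q c (x + y) a = polarForm q c x a + polarForm q c y a := by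
  simp only [polarForm, ← Finset.sum_add_distrib, add_pow_pow_of_charTwo hq]
  exact Finset.sum_congr rfl fun _ _ => by ring

theorem polarForm_comm (c : Fin m → Fin m → K) (x a : K) :
    polarForm q c x a = polarForm q c a x := by
  simp only [polarForm]
  exact Finset.sum_congr rfl fun _ _ => by ring

theorem polarForm_mul_left (c : Fin m → Fin m → K) {l : K} (hl : l ^ q = l) (x a : K) :
    polarForm q c (l * x) a = l * polarForm q c x a := by
  simp only [polarForm, Finset.mul_sum, mul_pow, pow_pow_eq_self_of_pow_eq_self hl]
  exact Finset.sum_congr rfl fun _ _ => by ring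

theorem polarForm_self [CharP K 2] (c : Fin m → Fin m → K) (a : K) : polarForm q c a a = 0 := by
  simp [polarForm, CharTwo.add_self_eq_zero]

theorem map_add_eq_add_polarForm [CharP K 2] (hq : q = 2 ^ e) {c : Fin m → Fin m → K} {F : K → K}
    (hF : ∀ x : K, F x =
      ∑ ij ∈ Finset.univ.filter (fun ij : Fin m × Fin m => ij.1 ≤ ij.2),
        c ij.1 ij.2 * x ^ (q ^ (ij.1 : ℕ) + q ^ (ij.2 : ℕ))) (x a : K) :
    F (x + a) = F x + F a + polarForm q c x a := by
  simp only [hF, polarForm, ← Finset.sum_add_distrib, pow_add, add_pow_pow_of_charTwo hq]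
  exact Finset.sum_congr rfl fun _ _ => by ring

theorem map_mul_of_pow_eq_self {c : Fin m → Fin m → K} {F : K → K}
    (hF : ∀ x : K, F x =
      ∑ ij ∈ Finset.univ.filter (fun ij : Fin m × Fin m => ij.1 ≤ ij.2),
        c ij.1 ij.2 * x ^ (q ^ (ij.1 : ℕ) + q ^ (ij.2 : ℕ))) {l : K} (hl : l ^ q = l) (a : K) :
    F (l * a) = l ^ 2 * F a := by
  simp only [hF, Finset.mul_sum, pow_add, mul_pow, pow_pow_eq_self_of_pow_eq_self hl]
  exact Finset.sum_congr rfl fun _ _ => by ring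

end PolarForm

theorem quadratic_optimal_boomerang {K : Type*} [Field K] [Fintype K] (e m q : ℕ)
    (he : 1 ≤ e) (hm : 0 < m) (hq : q = 2 ^ e) (hcard : Fintype.card K = q ^ m)
    (c : Fin m → Fin m → K) (F : K → K)
    (hF : ∀ x : K, F x =
      ∑ ij ∈ Finset.univ.filter (fun ij : Fin m × Fin m => ij.1 ≤ ij.2),
        c ij.1 ij.2 * x ^ (q ^ (ij.1 : ℕ) + q ^ (ij.2 : ℕ)))
    (hbij : Function.Bijective F) (hdelta : deltaU F = q) :
    betaU F = q := by
  have hchar : CharP K 2 := by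
    have h2 : ((2 : ℕ) : K) = 0 := by
      have h : ((2 ^ (e * m) : ℕ) : K) = 0 := by
        rw [pow_mul, ← hq, ← hcard]
        exact FiniteField.cast_card_eq_zero K
      rw [Nat.cast_pow] at h
      exact eq_zero_of_pow_eq_zero h
    exact CharTwo.of_one_ne_zero_of_two_eq_zero one_ne_zero (by exact_mod_cast h2)
  have hq2 : 2 ≤ q := hq ▸ Nat.le_self_pow (by omega) 2
  have hadd := map_add_eq_add_polarForm hq hF
  have hFmul := fun {l : K} (hl : l ^ q = l) (a : K) => map_mul_of_pow_eq_self hF hl a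
  have hF0 : F 0 = 0 := by simpa using hFmul (l := 0) (zero_pow (by omega)) 0
  have hFne : ∀ {a : K}, a ≠ 0 → F a ≠ 0 := fun ha h => ha (hbij.1 (h.trans hF0.symm))
  have hinv : ∀ y, F (Function.invFun F y) = y := Function.rightInverse_invFun hbij.2
  have hleft : ∀ y, Function.invFun F (F y) = y := Function.leftInverse_invFun hbij.1
  have hline : ∀ {a : K} (l : K), l ^ q = l → polarForm q c (l * a) a = 0 := by
    intro a l hl
    rw [polarForm_mul_left c hl, polarForm_self, mul_zero]
  have hlinecard : ∀ {a : K}, a ≠ 0 → q ≤ Set.ncard ((· * a) '' {l : K | l ^ q = l}) := by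
    intro a ha
    rw [Set.ncard_image_of_injective _ (mul_left_injective₀ ha)]
    exact le_ncard_pow_eq_self hq2 hcard
  have hkercard : ∀ {a : K}, a ≠ 0 → Set.ncard {x : K | polarForm q c x a = 0} ≤ q := by
    intro a ha
    have hle : DDT F a (F a) ≤ deltaU F :=
      Finset.le_sup (f := fun p : K × K => DDT F p.1 p.2) (b := (a, F a)) (by simp [ha, hFne ha])
    rw [hdelta] at hle
    refine le_of_eq_of_le (congrArg Set.ncard (Set.ext fun x => ?_)) hle
    simp only [Set.mem_ofPred_eq, hadd x a]
    grind [CharTwo.add_self_eq_zero (F x)]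
  have hker : ∀ {a : K}, a ≠ 0 →
      {x : K | polarForm q c x a = 0} = (· * a) '' {l : K | l ^ q = l} := by
    intro a ha
    refine (Set.eq_of_subset_of_ncard_le ?_ ((hkercard ha).trans (hlinecard ha))
      (Set.toFinite _)).symm
    rintro _ ⟨l, hl, rfl⟩
    exact hline l hl
  have himage : ∀ {a : K}, a ≠ 0 → ∀ w, polarForm q c w a ≠ F a := by
    intro a ha w hw
    have : F (w + a) = F w := by
      rw [hadd, hw, add_assoc, CharTwo.add_self_eq_zero, add_zero]
    exact ha (by simpa using hbij.1 this)
  have hBCT : ∀ {a b : K}, a ≠ 0 → ∀ {x : K},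
      Function.invFun F (F x + b) + Function.invFun F (F (x + a) + b) = a →
      ∃ l : K, l ^ q = l ∧ polarForm q c (l * x) a + l ^ 2 * F a = b := by
    intro a b ha x hx
    have hy := hinv (F x + b)
    have hz := hinv (F (x + a) + b)
    set y := Function.invFun F (F x + b)
    set z := Function.invFun F (F (x + a) + b)
    have hzy : z = y + a := by
      rw [← hx, ← add_assoc, CharTwo.add_self_eq_zero, zero_add]
    rw [hzy, hadd, hadd, hy] at hz
    have hxy : polarForm q c (x + y) a = 0 := by
      rw [polarForm_add_left hq]
      have hB : polarForm q c y a = polarForm q c x a := by linear_combination hz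
      rw [hB, CharTwo.add_self_eq_zero]
    obtain ⟨l, hl, hlxy⟩ := (hker ha).subset hxy
    have hl : l ^ q = l := hl
    refine ⟨l, hl, ?_⟩
    have hyx : y = x + l * a := by
      have hlxy : l * a = x + y := hlxy
      rw [hlxy, ← add_assoc, CharTwo.add_self_eq_zero, zero_add]
    rw [hyx, hadd, hFmul hl, polarForm_comm, polarForm_mul_left c hl, polarForm_comm] at hy
    rw [polarForm_mul_left c hl]
    linear_combination hy
  apply le_antisymm
  · refine Finset.sup_le ?_
    rintro ⟨a, b⟩ hab
    obtain ⟨ha, hb⟩ : a ≠ 0 ∧ b ≠ 0 := by simpa using hab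
    rw [BCT]
    rcases Set.eq_empty_or_nonempty {x : K |
      Function.invFun F (F x + b) + Function.invFun F (F (x + a) + b) = a} with hS | ⟨x₀, hx₀⟩
    · rw [hS]; simp
    obtain ⟨l₀, hl₀, h₀⟩ := hBCT ha hx₀
    refine le_trans ?_ (hkercard ha)
    refine Set.ncard_le_ncard_of_injOn (· + x₀) ?_ (add_left_injective x₀).injOn (Set.toFinite _)
    intro x hx
    obtain ⟨l, hl, h⟩ := hBCT (b := b) ha hx
    have hll : (l + l₀) ^ q = l + l₀ := by
      simpa [hl, hl₀] using add_pow_pow_of_charTwo hq l l₀ 1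
    have hsum : polarForm q c (l * x + l₀ * x₀) a = (l + l₀) ^ 2 * F a := by
      rw [polarForm_add_left hq, CharTwo.add_sq]
      have h2 : (2 : K) = 0 := CharTwo.two_eq_zero
      linear_combination h + h₀ + (b - l ^ 2 * F a - l₀ ^ 2 * F a) * h2
    have hl_eq : l = l₀ := by
      by_contra hne
      have hμ : l + l₀ ≠ 0 := fun h => hne (CharTwo.add_eq_zero.1 h)
      have hs : (((l + l₀) ^ 2)⁻¹) ^ q = ((l + l₀) ^ 2)⁻¹ := by
        rw [inv_pow, pow_right_comm, hll]
      apply himage ha (((l + l₀) ^ 2)⁻¹ * (l * x + l₀ * x₀))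
      rw [polarForm_mul_left c hs, hsum]
      field_simp
    subst hl_eq
    have hl0 : l ≠ 0 := by
      rintro rfl
      apply hb
      rw [← h, polarForm_mul_left c hl]
      ring
    rw [← mul_add, polarForm_mul_left c hl, CharTwo.add_self_eq_zero] at hsum
    simpa [hl0] using hsum
  · have hle : BCT F 1 (F 1) ≤ betaU F :=
      Finset.le_sup (f := fun p : K × K => BCT F p.1 p.2) (b := (1, F 1))
        (by simp [hFne one_ne_zero])
    refine le_trans ?_ hle
    refine (hlinecard (one_ne_zero (α := K))).trans (Set.ncard_le_ncard ?_ (Set.toFinite _))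
    rintro _ ⟨l, hl, rfl⟩
    have hB : polarForm q c (l * 1) 1 = 0 := hline l hl
    have h1 : F (l * 1) + F 1 = F (l * 1 + 1) := by rw [hadd, hB, add_zero]
    change Function.invFun F (F (l * 1) + F 1) + Function.invFun F (F (l * 1 + 1) + F 1) = 1
    rw [← h1, add_assoc (F (l * 1)), CharTwo.add_self_eq_zero, add_zero, h1, hleft, hleft,
      add_right_comm, CharTwo.add_self_eq_zero, zero_add]
end

section
/- Let q = 2^e (e ≥ 1) be a power of 2 and m a positive integer. Let F : GF(q^m) → GF(q^m) be a permutation of the form F(x) = Σ_{0 ≤ i ≤ j ≤ m−1} c_{ij} x^{q^i + q^j} with coefficients c_{ij} ∈ GF(q^m), and suppose Δ(F) = q. Then for every nonzero a in GF(q^m) and nonzero b in GF(q^m), there is at most one nonzero γ in the subfield GF(q) such that DDT_F(aγ, b) ≠ 0. -/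
open scoped Classical

/-- The polar form of `x ↦ ∑ k ∈ s, c k * x ^ (q ^ u k + q ^ v k)` in characteristic two. -/
def dembowskiOstromPolar {K ι : Type*} [Field K] (q : ℕ) (s : Finset ι) (c : ι → K) (u v : ι → ℕ)
    (x y : K) : K :=
  ∑ k ∈ s, c k * (x ^ q ^ u k * y ^ q ^ v k + x ^ q ^ v k * y ^ q ^ u k)

section DembowskiOstrom

variable {K ι : Type*} [Field K] {q e : ℕ} (s : Finset ι) (c : ι → K) (u v : ι → ℕ)

theorem pow_pow_eq_self {γ : K} (h : γ ^ q = γ) (n : ℕ) : γ ^ q ^ n = γ := by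
  induction n with
  | zero => simp
  | succ n ih => rw [pow_succ, pow_mul, ih, h]

theorem add_pow_two_pow_pow [CharP K 2] (hq : q = 2 ^ e) (x y : K) (n : ℕ) :
    (x + y) ^ q ^ n = x ^ q ^ n + y ^ q ^ n := by
  rw [hq, ← pow_mul]
  exact add_pow_char_pow x y 2 _

theorem dembowskiOstrom_add [CharP K 2] (hq : q = 2 ^ e) (x y : K) :
    ∑ k ∈ s, c k * (x + y) ^ (q ^ u k + q ^ v k) =
      ∑ k ∈ s, c k * x ^ (q ^ u k + q ^ v k) + ∑ k ∈ s, c k * y ^ (q ^ u k + q ^ v k) +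
        dembowskiOstromPolar q s c u v x y := by
  rw [dembowskiOstromPolar, ← Finset.sum_add_distrib, ← Finset.sum_add_distrib]
  refine Finset.sum_congr rfl fun k _ => ?_
  simp only [pow_add, add_pow_two_pow_pow hq]
  ring

theorem dembowskiOstrom_mul {γ : K} (h : γ ^ q = γ) (x : K) :
    ∑ k ∈ s, c k * (x * γ) ^ (q ^ u k + q ^ v k) =
      γ ^ 2 * ∑ k ∈ s, c k * x ^ (q ^ u k + q ^ v k) := by
  rw [Finset.mul_sum]
  refine Finset.sum_congr rfl fun k _ => ?_
  simp only [pow_add, mul_pow, pow_pow_eq_self h]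
  ring

theorem dembowskiOstromPolar_add_left [CharP K 2] (hq : q = 2 ^ e) (x y z : K) :
    dembowskiOstromPolar q s c u v (x + y) z =
      dembowskiOstromPolar q s c u v x z + dembowskiOstromPolar q s c u v y z := by
  simp only [dembowskiOstromPolar]
  rw [← Finset.sum_add_distrib]
  refine Finset.sum_congr rfl fun k _ => ?_
  simp only [add_pow_two_pow_pow hq]
  ring

theorem dembowskiOstromPolar_mul_left {γ : K} (h : γ ^ q = γ) (x y : K) :
    dembowskiOstromPolar q s c u v (γ * x) y = γ * dembowskiOstromPolar q s c u v x y := by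
  simp only [dembowskiOstromPolar]
  rw [Finset.mul_sum]
  refine Finset.sum_congr rfl fun k _ => ?_
  simp only [mul_pow, pow_pow_eq_self h]
  ring

theorem dembowskiOstromPolar_mul_right {γ : K} (h : γ ^ q = γ) (x y : K) :
    dembowskiOstromPolar q s c u v x (y * γ) = γ * dembowskiOstromPolar q s c u v x y := by
  simp only [dembowskiOstromPolar]
  rw [Finset.mul_sum]
  refine Finset.sum_congr rfl fun k _ => ?_
  simp only [mul_pow, pow_pow_eq_self h]
  ring

end DembowskiOstrom

theorem exists_of_DDT_ne_zero {K : Type*} [Field K] {F : K → K} {a b : K} (h : DDT F a b ≠ 0) :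
    ∃ x, F (x + a) + F x = b :=
  Set.nonempty_of_ncard_ne_zero h

theorem at_most_one_nonzero_gamma {K : Type*} [Field K] [Fintype K] (e m q : ℕ)
    (he : 1 ≤ e) (hm : 0 < m) (hq : q = 2 ^ e) (hcard : Fintype.card K = q ^ m)
    (c : Fin m → Fin m → K) (F : K → K)
    (hF : ∀ x : K, F x =
      ∑ ij ∈ Finset.univ.filter (fun ij : Fin m × Fin m => ij.1 ≤ ij.2),
        c ij.1 ij.2 * x ^ (q ^ (ij.1 : ℕ) + q ^ (ij.2 : ℕ)))
    (hbij : Function.Bijective F) (hdelta : deltaU F = q)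
    (a b : K) (ha : a ≠ 0) (hb : b ≠ 0) :
    ∀ γ₁ γ₂ : K, γ₁ ^ q = γ₁ → γ₂ ^ q = γ₂ → γ₁ ≠ 0 → γ₂ ≠ 0 →
      DDT F (a * γ₁) b ≠ 0 → DDT F (a * γ₂) b ≠ 0 → γ₁ = γ₂ := by
  intro γ₁ γ₂ h₁ h₂ _ _ hd₁ hd₂
  obtain ⟨x₁, hx₁⟩ := exists_of_DDT_ne_zero hd₁
  obtain ⟨x₂, hx₂⟩ := exists_of_DDT_ne_zero hd₂
  have : Fact (Nat.Prime 2) := ⟨Nat.prime_two⟩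
  have : CharP K 2 := charP_of_card_eq_prime_pow (f := e * m) (by rw [hcard, hq, ← pow_mul])
  obtain ⟨s, hs⟩ : ∃ s : Finset (Fin m × Fin m), ∀ x, F x =
      ∑ ij ∈ s, c ij.1 ij.2 * x ^ (q ^ (ij.1 : ℕ) + q ^ (ij.2 : ℕ)) := ⟨_, hF⟩
  obtain ⟨B, hadd, hBadd, hBl, hBr, hsq⟩ : ∃ B : K → K → K,
      (∀ x y, F (x + y) = F x + F y + B x y) ∧
      (∀ x y z, B (x + y) z = B x z + B y z) ∧
      (∀ γ, γ ^ q = γ → ∀ x y, B (γ * x) y = γ * B x y) ∧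
      (∀ γ, γ ^ q = γ → ∀ x y, B x (y * γ) = γ * B x y) ∧
      (∀ γ, γ ^ q = γ → ∀ x, F (x * γ) = γ ^ 2 * F x) := by
    refine ⟨_, fun x y => ?_,
      dembowskiOstromPolar_add_left s (fun ij : Fin m × Fin m => c ij.1 ij.2)
        (fun ij => (ij.1 : ℕ)) (fun ij => (ij.2 : ℕ)) hq,
      fun γ h => dembowskiOstromPolar_mul_left _ _ _ _ h,
      fun γ h => dembowskiOstromPolar_mul_right _ _ _ _ h, fun γ h x => ?_⟩
    · rw [hs, hs x, hs y]
      exact dembowskiOstrom_add _ _ _ _ hq x y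
    · rw [hs, hs x]
      exact dembowskiOstrom_mul _ _ (fun ij : Fin m × Fin m => (ij.1 : ℕ))
        (fun ij => (ij.2 : ℕ)) h x
  by_contra hne
  set δ := γ₁ + γ₂ with hδ
  have hδ0 : δ ≠ 0 := fun h => hne (CharTwo.add_eq_zero.mp h)
  have hδq : δ ^ q = δ := by
    simpa [h₁, h₂] using add_pow_two_pow_pow hq γ₁ γ₂ 1
  have hinv : (δ⁻¹ ^ 2) ^ q = δ⁻¹ ^ 2 := by
    rw [← pow_mul, mul_comm, pow_mul, inv_pow, hδq]
  rw [hadd, hsq _ h₁, hBr _ h₁] at hx₁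
  rw [hadd, hsq _ h₂, hBr _ h₂] at hx₂
  have htwo : (2 : K) = 0 := CharTwo.two_eq_zero
  have key : δ ^ 2 * F a = B (γ₁ * x₁ + γ₂ * x₂) a := by
    rw [hBadd, hBl _ h₁, hBl _ h₂, hδ]
    linear_combination hx₁ - hx₂ + (γ₁ * γ₂ * F a + γ₂ ^ 2 * F a - γ₁ * B x₁ a
      - F x₁ + F x₂) * htwo
  have hFa : B (δ⁻¹ ^ 2 * (γ₁ * x₁ + γ₂ * x₂)) a = F a := by
    rw [hBl _ hinv, ← key]
    field_simp
  have hcollide := hadd (δ⁻¹ ^ 2 * (γ₁ * x₁ + γ₂ * x₂)) a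
  rw [hFa, add_assoc, CharTwo.add_self_eq_zero, add_zero] at hcollide
  exact ha (by simpa using hbij.injective hcollide)
end

section
/- Let n be a positive integer with n ≡ 2 (mod 4) and let t be an even positive integer with gcd(t,n) = 2. Then the Gold function F(x) = x^{2^t + 1} is a permutation of GF(2^n) with boomerang uniformity β(F) = 4. -/
open scoped Classical

section Gold

variable {K : Type*} [Field K]

/-- The elements of `K` lying in the subfield with four elements. -/
def quarticFixed (K : Type*) [Field K] : Set K := {z : K | z ^ 4 = z}

theorem ncard_quarticFixed_le [Fintype K] : (quarticFixed K).ncard ≤ 4 := by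
  have hdeg : (Polynomial.X ^ 4 - Polynomial.X : Polynomial K).natDegree = 4 :=
    FiniteField.X_pow_card_sub_X_natDegree_eq K (by norm_num)
  have hne : (Polynomial.X ^ 4 - Polynomial.X : Polynomial K) ≠ 0 :=
    FiniteField.X_pow_card_sub_X_ne_zero K (by norm_num)
  have hsub : quarticFixed K ⊆
      ((Polynomial.X ^ 4 - Polynomial.X : Polynomial K).roots.toFinset : Set K) := by
    intro z hz
    have hz' : z ^ 4 = z := hz
    simp [hne, hz']
  calc (quarticFixed K).ncard
      ≤ ((Polynomial.X ^ 4 - Polynomial.X : Polynomial K).roots.toFinset : Set K).ncard :=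
        Set.ncard_le_ncard hsub (Finset.finite_toSet _)
    _ = (Polynomial.X ^ 4 - Polynomial.X : Polynomial K).roots.toFinset.card :=
        Set.ncard_coe_finset _
    _ ≤ (Polynomial.X ^ 4 - Polynomial.X : Polynomial K).roots.card :=
        Multiset.toFinset_card_le _
    _ ≤ 4 := (Polynomial.card_roots' _).trans_eq hdeg

theorem four_le_ncard_quarticFixed [Fintype K] {n : ℕ} (hn : Even n)
    (hcard : Fintype.card K = 2 ^ n) : 4 ≤ (quarticFixed K).ncard := by
  have hdvd : 3 ∣ Fintype.card Kˣ := by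
    obtain ⟨k, rfl⟩ := hn
    rw [Fintype.card_units, hcard, ← two_mul, pow_mul]
    simpa using Nat.sub_dvd_pow_sub_pow 4 1 k
  have : Fact (Nat.Prime 3) := ⟨Nat.prime_three⟩
  obtain ⟨u, hu⟩ := exists_prime_orderOf_dvd_card 3 hdvd
  have h3 : (u : K) ^ 3 = 1 := by
    have := pow_orderOf_eq_one u
    rw [hu] at this
    simpa using congrArg Units.val this
  have h1 : (u : K) ≠ 1 := by
    intro h
    have : u = 1 := Units.ext h
    simp [this] at hu
  have h0 : (u : K) ≠ 0 := u.ne_zero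
  have h2 : (u : K) ^ 2 ≠ 1 := fun h => h1 (by linear_combination h3 - u * h)
  have h12 : (u : K) ≠ (u : K) ^ 2 := fun h => h1 (by
    apply mul_left_cancel₀ h0
    linear_combination -h)
  have hc : ({0, 1, (u : K), (u : K) ^ 2} : Finset K).card = 4 := by
    rw [Finset.card_insert_of_notMem, Finset.card_insert_of_notMem, Finset.card_pair h12]
    · simp [h1.symm, h2.symm]
    · simp [h0.symm, (pow_ne_zero 2 h0).symm]
  rw [← hc, ← Set.ncard_coe_finset]
  refine Set.ncard_le_ncard ?_ (Set.toFinite _)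
  intro z hz
  simp only [Finset.coe_insert, Finset.coe_singleton, Set.mem_insert_iff,
    Set.mem_singleton_iff] at hz
  change z ^ 4 = z
  rcases hz with rfl | rfl | rfl | rfl
  · simp
  · simp
  · linear_combination (u : K) * h3
  · linear_combination ((u : K) ^ 5 + (u : K) ^ 2) * h3

variable [CharP K 2]

theorem mem_quarticFixed_of_pow_eq [Fintype K] {n t : ℕ} (hcard : Fintype.card K = 2 ^ n)
    (hgcd : Nat.gcd t n = 2) {x : K} (hx : x ^ 2 ^ t = x) : x ∈ quarticFixed K := by
  have ht : Function.IsPeriodicPt (frobenius K 2) t x := by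
    rw [Function.IsPeriodicPt, Function.IsFixedPt, iterate_frobenius, hx]
  have hn : Function.IsPeriodicPt (frobenius K 2) n x := by
    rw [Function.IsPeriodicPt, Function.IsFixedPt, iterate_frobenius, ← hcard,
      FiniteField.pow_card]
  have h := ht.gcd hn
  rw [hgcd, Function.IsPeriodicPt, Function.IsFixedPt, iterate_frobenius] at h
  exact h

theorem pow_eq_of_mem_quarticFixed {t : ℕ} (ht : Even t) {x : K}
    (hx : x ∈ quarticFixed K) : x ^ 2 ^ t = x := by
  have h2 : Function.IsPeriodicPt (frobenius K 2) 2 x := by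
    rw [Function.IsPeriodicPt, Function.IsFixedPt, iterate_frobenius]
    exact hx
  obtain ⟨k, rfl⟩ := ht.two_dvd
  have h := h2.mul_const k
  rwa [Function.IsPeriodicPt, Function.IsFixedPt, iterate_frobenius] at h

theorem pow_add_self_ne_one [Fintype K] {n t : ℕ} (hcard : Fintype.card K = 2 ^ n)
    (hn4 : n % 4 = 2) (ht : Even t) (z : K) : z ^ 2 ^ t + z ≠ 1 := by
  intro hz
  have hstep : z ^ 2 ^ t = z + 1 := by
    linear_combination hz - CharTwo.add_self_eq_zero z
  have hiter : ∀ k : ℕ, z ^ 2 ^ (t * k) = z + k := by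
    intro k
    induction k with
    | zero => simp
    | succ k ih =>
      rw [mul_add, mul_one, pow_add, pow_mul, ih, add_pow_char_pow, hstep]
      have hk : (k : K) ^ 2 ^ t = k := by
        have := map_natCast (iterateFrobenius K 2 t) k
        rwa [iterateFrobenius_def] at this
      rw [hk]
      push_cast
      ring
  obtain ⟨s, rfl⟩ := ht.two_dvd
  obtain ⟨m, rfl⟩ : ∃ m, n = 2 * (2 * m + 1) := ⟨n / 4, by omega⟩
  have h := hiter (2 * m + 1)
  rw [show 2 * s * (2 * m + 1) = 2 * (2 * m + 1) * s by ring, pow_mul, ← hcard,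
    FiniteField.pow_card_pow] at h
  push_cast at h
  rw [CharTwo.two_eq_zero] at h
  simp at h

theorem gold_injective [Fintype K] {n t : ℕ} (hcard : Fintype.card K = 2 ^ n)
    (hn4 : n % 4 = 2) (ht : Even t) (hgcd : Nat.gcd t n = 2) :
    Function.Injective (fun x : K => x ^ (2 ^ t + 1)) := by
  have hone : ∀ x : K, x ^ (2 ^ t + 1) = 1 → x = 1 := by
    intro x hx
    have hx0 : x ≠ 0 := by
      rintro rfl
      simp at hx
    have hinv : x ^ 2 ^ t = x⁻¹ := eq_inv_of_mul_eq_one_left (by rwa [← pow_succ])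
    have hsq : x ^ 2 ^ (2 * t) = x := by
      rw [two_mul, pow_add, pow_mul, hinv, inv_pow, hinv, inv_inv]
    have hgcd' : Nat.gcd (2 * t) n = 2 := by
      obtain ⟨s, rfl⟩ := ht.two_dvd
      obtain ⟨m, rfl⟩ : ∃ m, n = 2 * (2 * m + 1) := ⟨n / 4, by omega⟩
      rw [Nat.gcd_mul_left] at hgcd ⊢
      have hco : Nat.Coprime 2 (2 * m + 1) := by simp
      rw [hco.gcd_mul_left_cancel]
      exact hgcd
    have hfix := pow_eq_of_mem_quarticFixed ht (mem_quarticFixed_of_pow_eq hcard hgcd' hsq)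
    rw [pow_succ, hfix] at hx
    have : (x + 1) ^ 2 = 0 := by
      linear_combination hx + (x + 1) * CharTwo.two_eq_zero (R := K)
    have := pow_eq_zero_iff (two_ne_zero) |>.1 this
    exact CharTwo.add_eq_zero.1 this
  intro x y hxy
  simp only at hxy
  by_cases hy : y = 0
  · subst hy
    rw [zero_pow (by positivity)] at hxy
    exact (pow_eq_zero_iff (by positivity)).1 hxy
  · have : x / y = 1 := hone _ (by rw [div_pow, hxy, div_self (pow_ne_zero _ hy)])
    exact (div_eq_one_iff_eq hy).1 this

/-- A point counted by `BCT` for a bijective Gold function, rescaled by `a`, solves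
`z ^ 2 ^ t + z = b / a ^ (2 ^ t + 1) * w ^ 2 + w` for some nonzero `w` in the subfield with four
elements. -/
theorem exists_of_gold_boomerang [Fintype K] {n t : ℕ} (hcard : Fintype.card K = 2 ^ n)
    (hgcd : Nat.gcd t n = 2) {a b x y : K} (ha : a ≠ 0) (hb : b ≠ 0)
    (hy : y ^ (2 ^ t + 1) = x ^ (2 ^ t + 1) + b)
    (hya : (y + a) ^ (2 ^ t + 1) = (x + a) ^ (2 ^ t + 1) + b) :
    ∃ w ∈ quarticFixed K, w ^ 3 = 1 ∧
      (x / a) ^ 2 ^ t + x / a = b / a ^ (2 ^ t + 1) * w ^ 2 + w := by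
  obtain ⟨z, rfl⟩ : ∃ z, x = a * z := ⟨x / a, by field_simp⟩
  obtain ⟨w, rfl⟩ : ∃ w, y = a * (z + w) := ⟨y / a - z, by field_simp; ring⟩
  have haq : a ^ (2 ^ t + 1) ≠ 0 := pow_ne_zero _ ha
  obtain ⟨β, rfl⟩ : ∃ β, b = a ^ (2 ^ t + 1) * β := ⟨b / a ^ (2 ^ t + 1), by field_simp⟩
  rw [mul_div_cancel_left₀ _ ha, mul_div_cancel_left₀ _ haq]
  have hy' : (z + w) ^ (2 ^ t + 1) = z ^ (2 ^ t + 1) + β := by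
    apply mul_left_cancel₀ haq
    rw [← mul_pow, hy, mul_pow, mul_add]
  have hya' : (z + w + 1) ^ (2 ^ t + 1) = (z + 1) ^ (2 ^ t + 1) + β := by
    apply mul_left_cancel₀ haq
    rw [← mul_pow, mul_add a, mul_one, hya, mul_add, ← mul_pow, mul_add a, mul_one]
  simp only [pow_succ _ (2 ^ t), add_pow_char_pow, one_pow] at hy' hya'
  have h2 := CharTwo.two_eq_zero (R := K)
  have hfix : w ^ 2 ^ t = w := by
    linear_combination hya' - hy' - w * h2
  have hw : w ∈ quarticFixed K := mem_quarticFixed_of_pow_eq hcard hgcd hfix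
  have hw4 : w ^ 4 = w := hw
  rw [hfix] at hy'
  have hw0 : w ≠ 0 := by
    rintro rfl
    apply hb
    have : β = 0 := by linear_combination -hy'
    simp [this]
  have hw3 : w ^ 3 = 1 := mul_left_cancel₀ hw0 (by linear_combination hw4)
  refine ⟨w, hw, hw3, ?_⟩
  linear_combination w ^ 2 * hy' - (z ^ 2 ^ t + z) * hw3 - hw4 - w * h2

/-- The rescaled points counted by one entry of the `BCT` of a Gold function differ by elements
of the subfield with four elements. -/
theorem add_mem_quarticFixed_of_gold [Fintype K] {n t : ℕ} (hcard : Fintype.card K = 2 ^ n)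
    (hn4 : n % 4 = 2) (ht : Even t) (hgcd : Nat.gcd t n = 2) {β w₁ w₂ z₁ z₂ : K}
    (hw₁ : w₁ ∈ quarticFixed K) (hw₂ : w₂ ∈ quarticFixed K) (h₁ : w₁ ^ 3 = 1) (h₂ : w₂ ^ 3 = 1)
    (hz₁ : z₁ ^ 2 ^ t + z₁ = β * w₁ ^ 2 + w₁) (hz₂ : z₂ ^ 2 ^ t + z₂ = β * w₂ ^ 2 + w₂) :
    z₁ + z₂ ∈ quarticFixed K := by
  have h2 := CharTwo.two_eq_zero (R := K)
  by_cases hw : w₁ = w₂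
  · subst hw
    apply mem_quarticFixed_of_pow_eq hcard hgcd
    rw [add_pow_char_pow]
    linear_combination hz₁ - hz₂ + (z₂ ^ 2 ^ t - z₁) * h2
  · have hquad : w₁ ^ 2 + w₁ * w₂ + w₂ ^ 2 = 0 := by
      apply mul_left_cancel₀ (sub_ne_zero.2 hw)
      linear_combination h₁ - h₂
    refine absurd ?_ (pow_add_self_ne_one hcard hn4 ht (w₂ ^ 2 * z₁ + w₁ ^ 2 * z₂))
    rw [add_pow_char_pow, mul_pow, mul_pow, pow_right_comm w₁, pow_right_comm w₂,
      pow_eq_of_mem_quarticFixed ht hw₁, pow_eq_of_mem_quarticFixed ht hw₂]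
    linear_combination w₂ ^ 2 * hz₁ + w₁ ^ 2 * hz₂ + w₁ * hquad - h₁
      + (β * w₁ ^ 2 * w₂ ^ 2 - 1) * h2

theorem BCT_gold_le_four [Fintype K] {n t : ℕ} (hcard : Fintype.card K = 2 ^ n)
    (hn4 : n % 4 = 2) (ht : Even t) (hgcd : Nat.gcd t n = 2)
    (hbij : Function.Bijective (fun x : K => x ^ (2 ^ t + 1))) {a b : K}
    (ha : a ≠ 0) (hb : b ≠ 0) : BCT (fun x : K => x ^ (2 ^ t + 1)) a b ≤ 4 := by
  have hinv := fun v => Function.invFun_eq (hbij.surjective v)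
  unfold BCT
  set S : Set K := {x : K | _} with hS
  have key : ∀ x ∈ S, ∃ w ∈ quarticFixed K, w ^ 3 = 1 ∧
      (x / a) ^ 2 ^ t + x / a = b / a ^ (2 ^ t + 1) * w ^ 2 + w := by
    intro x hx
    rw [hS, Set.mem_ofPred_eq] at hx
    refine exists_of_gold_boomerang hcard hgcd ha hb (hinv _) ?_
    rw [← hinv ((x + a) ^ (2 ^ t + 1) + b)]
    congr 1
    exact (congrArg _ hx.symm).trans (CharTwo.add_cancel_left _ _)
  rcases S.eq_empty_or_nonempty with hempty | ⟨x₀, hx₀⟩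
  · simp [hempty]
  obtain ⟨w₀, hw₀, h₀, hz₀⟩ := key x₀ hx₀
  have hsub : S ⊆ (fun z => a * z + x₀) '' quarticFixed K := by
    intro x hx
    obtain ⟨w, hw, h, hz⟩ := key x hx
    refine ⟨_, add_mem_quarticFixed_of_gold hcard hn4 ht hgcd hw hw₀ h h₀ hz hz₀, ?_⟩
    simp only [mul_add, mul_div_cancel₀ _ ha]
    exact CharTwo.add_cancel_right _ _
  exact (Set.ncard_le_ncard hsub (Set.toFinite _)).trans
    ((Set.ncard_image_le (Set.toFinite _)).trans ncard_quarticFixed_le)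

theorem four_le_BCT_gold_one_one [Fintype K] {n t : ℕ} (hcard : Fintype.card K = 2 ^ n)
    (hn : Even n) (ht : Even t)
    (hinj : Function.Injective (fun x : K => x ^ (2 ^ t + 1))) :
    4 ≤ BCT (fun x : K => x ^ (2 ^ t + 1)) 1 1 := by
  refine (four_le_ncard_quarticFixed hn hcard).trans (Set.ncard_le_ncard ?_ (Set.toFinite _))
  intro x hx
  have hfix := pow_eq_of_mem_quarticFixed ht hx
  have h2 := CharTwo.two_eq_zero (R := K)
  have hadd : x ^ (2 ^ t + 1) + 1 = (x + 1) ^ (2 ^ t + 1) := by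
    rw [pow_succ, pow_succ, add_pow_char_pow, hfix, one_pow]
    linear_combination -x * h2
  have hadd' : (x + 1) ^ (2 ^ t + 1) + 1 = x ^ (2 ^ t + 1) := by
    rw [← hadd, CharTwo.add_cancel_right]
  have hleft := Function.leftInverse_invFun hinj
  have e₁ := hleft (x + 1)
  have e₂ := hleft x
  rw [Set.mem_ofPred_eq]
  simp only at e₁ e₂ ⊢
  rw [hadd, hadd', e₁, e₂]
  linear_combination x * h2

end Gold

theorem gold_function_boomerang_four {K : Type*} [Field K] [Fintype K] (n t : ℕ)
    (hn : 0 < n) (hn4 : n % 4 = 2) (ht : 0 < t) (hteven : Even t)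
    (hgcd : Nat.gcd t n = 2) (hcard : Fintype.card K = 2 ^ n) :
    Function.Bijective (fun x : K => x ^ (2 ^ t + 1)) ∧
      betaU (fun x : K => x ^ (2 ^ t + 1)) = 4 := by
  have : CharP K 2 := by
    apply CharTwo.of_one_ne_zero_of_two_eq_zero one_ne_zero
    have h := FiniteField.cast_card_eq_zero K
    rw [hcard] at h
    push_cast at h
    exact (pow_eq_zero_iff hn.ne').1 h
  have hinj := gold_injective hcard hn4 hteven hgcd
  have hbij := Finite.injective_iff_bijective.1 hinj
  refine ⟨hbij, le_antisymm ?_ ?_⟩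
  · refine Finset.sup_le fun p hp => ?_
    rw [Finset.mem_filter] at hp
    exact BCT_gold_le_four hcard hn4 hteven hgcd hbij hp.2.1 hp.2.2
  · have hn : Even n := Nat.even_iff.2 (by omega)
    exact (four_le_BCT_gold_one_one hcard hn hteven hinj).trans
      (Finset.le_sup (f := fun p : K × K => BCT (fun x : K => x ^ (2 ^ t + 1)) p.1 p.2)
        (b := (1, 1)) (by simp))
end

section
/- Let m be an odd positive integer, n = 2m, and let λ be a nonzero element of GF(2^n) such that λ^{2^m − 1} has multiplicative order 3. Then the function F(x) = x^{2^m + 2} + λx is a permutation of GF(2^n) with boomerang uniformity β(F) = 4. -/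
open scoped Classical

section

variable {K : Type*} [Field K]

/-- A cube root of unity fixed by an endomorphism that squares cube roots of unity is `1`. -/
lemma eq_one_of_pow_three_eq_one_of_fixed {σ : K →+* K} (hcube : ∀ z : K, z ^ 3 = 1 → σ z = z ^ 2)
    {z : K} (hz : z ^ 3 = 1) (hfix : σ z = z) : z = 1 := by
  have h := hcube z hz
  have h0 : z ≠ 0 := by rintro rfl; simp at hz
  rw [hfix] at h
  have : z * (z - 1) = 0 := by linear_combination -h
  rcases mul_eq_zero.1 this with h | h
  · exact absurd h h0
  · exact sub_eq_zero.1 h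

/-- Cubing is injective on the fixed field. -/
lemma eq_of_pow_three_eq_of_fixed {σ : K →+* K} (hcube : ∀ z : K, z ^ 3 = 1 → σ z = z ^ 2)
    {x y : K} (hx : σ x = x) (hy : σ y = y) (h : x ^ 3 = y ^ 3) : x = y := by
  by_cases hy0 : y = 0
  · subst hy0; simpa using h
  have h1 : (x / y) ^ 3 = 1 := by rw [div_pow, h, div_self (pow_ne_zero _ hy0)]
  have h2 : σ (x / y) = x / y := by rw [map_div₀, hx, hy]
  exact (div_eq_one_iff_eq hy0).1 (eq_one_of_pow_three_eq_one_of_fixed hcube h1 h2)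

/-- The polynomial `w ^ 2 + w + 1` has no root in the fixed field. -/
lemma sq_add_self_add_one_ne_zero_of_fixed {σ : K →+* K} (h2 : (2 : K) = 0)
    (hcube : ∀ z : K, z ^ 3 = 1 → σ z = z ^ 2) {w : K} (hw : σ w = w) :
    w ^ 2 + w + 1 ≠ 0 := by
  intro h
  have h1 : w = 1 := eq_one_of_pow_three_eq_one_of_fixed hcube
    (by linear_combination (w - 1) * h) hw
  subst h1
  exact one_ne_zero (by linear_combination h - h2 : (1 : K) = 0)

/-- The binomial `x̄ x² + λ x` is injective when `λ̄ = ω λ` with `ω` a primitive cube root of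
unity. -/
lemma binomial_injective {σ : K →+* K} (h2 : (2 : K) = 0) (hσ : ∀ x, σ (σ x) = x)
    (hcube : ∀ z : K, z ^ 3 = 1 → σ z = z ^ 2) {ω lam : K} (hω : ω ^ 2 + ω + 1 = 0)
    (hω1 : ω ≠ 1) (hlam : lam ≠ 0) (hσlam : σ lam = ω * lam) :
    Function.Injective fun x : K => σ x * x ^ 2 + lam * x := by
  intro x y hxy
  have hω3 : ω ^ 3 = 1 := by linear_combination (ω - 1) * hω
  have hσω := hcube ω hω3
  have hcubic : ∀ z, (z * σ z + ω ^ 2 * lam) ^ 3 =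
      (σ z * z ^ 2 + lam * z) * σ (σ z * z ^ 2 + lam * z) + lam ^ 3 := by
    intro z
    simp only [map_add, map_mul, map_pow, hσ, hσlam]
    grind
  have hfix : ∀ z, σ (z * σ z + ω ^ 2 * lam) = z * σ z + ω ^ 2 * lam := by
    intro z
    simp only [map_add, map_mul, map_pow, hσ, hσlam, hσω]
    linear_combination ω ^ 2 * lam * hω3
  have hN : x * σ x = y * σ y := by
    refine add_right_cancel (eq_of_pow_three_eq_of_fixed hcube (hfix x) (hfix y) ?_)
    rw [hcubic, hcubic]
    simp only at hxy
    rw [hxy]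
  have hne : y * σ y + lam ≠ 0 := by
    intro h
    have h' := congrArg σ h
    simp only [map_add, map_mul, hσ, hσlam, map_zero] at h'
    have : (ω - 1) * lam = 0 := by linear_combination h' - h
    rcases mul_eq_zero.1 this with h | h
    · exact hω1 (sub_eq_zero.1 h)
    · exact hlam h
  refine mul_right_cancel₀ hne ?_
  simp only at hxy
  linear_combination hxy - x * hN

/-- The elements `1 + λ / N` with `N` fixed are not of the form `u² + ū`. -/
lemma mul_sq_add_conj_ne {σ : K →+* K} (h2 : (2 : K) = 0) (hσ : ∀ x, σ (σ x) = x)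
    (hcube : ∀ z : K, z ^ 3 = 1 → σ z = z ^ 2) {ω lam : K} (hω : ω ^ 2 + ω + 1 = 0)
    (hσlam : σ lam = ω * lam) {N : K} (hN0 : N ≠ 0) (hN : σ N = N) (u : K) :
    N * (u ^ 2 + σ u) ≠ N + lam := by
  intro h
  have hω3 : ω ^ 3 = 1 := by linear_combination (ω - 1) * hω
  have hσω := hcube ω hω3
  have h' := congrArg σ h
  simp only [map_add, map_mul, map_pow, hσ, hσlam, hN] at h'
  have hw : σ (ω * u + ω ^ 2 * σ u) = ω * u + ω ^ 2 * σ u := by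
    simp only [map_add, map_mul, map_pow, hσ, hσω]
    linear_combination ω * u * hω3
  refine sq_add_self_add_one_ne_zero_of_fixed h2 hcube hw (mul_left_cancel₀ hN0 ?_)
  grind

/-- The polar form `ā x² + a² x̄` of the cubic binomial vanishes only on the multiples of `a` by
roots of `t⁴ = t`. -/
lemma exists_mul_of_polar_eq_zero {σ : K →+* K} (h2 : (2 : K) = 0) (hσ : ∀ x, σ (σ x) = x)
    {ω : K} (hω : ω ^ 2 + ω + 1 = 0) {a x : K} (ha : a ≠ 0)
    (h : σ a * x ^ 2 + a ^ 2 * σ x = 0) :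
    x = a * 0 ∨ x = a * 1 ∨ x = a * ω ∨ x = a * ω ^ 2 := by
  obtain ⟨u, rfl⟩ : ∃ u, x = a * u := ⟨x / a, by field_simp⟩
  have hσa : σ a ≠ 0 := by simpa using ha
  have h1 : σ u = u ^ 2 := by
    have : σ a * a ^ 2 * (u ^ 2 + σ u) = 0 := by
      rw [map_mul] at h
      linear_combination h
    rcases mul_eq_zero.1 this with h | h
    · exact absurd h (mul_ne_zero hσa (pow_ne_zero _ ha))
    · linear_combination h - u ^ 2 * h2
  have h4 : u = u ^ 4 := by
    have := congrArg σ h1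
    rw [hσ, map_pow, h1] at this
    linear_combination this
  have hprod : u * ((u - 1) * ((u - ω) * (u - ω ^ 2))) = 0 := by
    linear_combination (-1 : K) * h4 + (u * (u - 1) * (-u + ω - 1)) * hω
  rcases mul_eq_zero.1 hprod with h | h
  · left; rw [h]
  rcases mul_eq_zero.1 h with h | h
  · right; left; rw [sub_eq_zero.1 h]
  rcases mul_eq_zero.1 h with h | h
  · right; right; left; rw [sub_eq_zero.1 h]
  · right; right; right; rw [sub_eq_zero.1 h]

/-- If `F(x) + F(x + a t) = F(y) + F(y + a s)` with `F(x) = x̄ x² + λ x` and cube roots of unity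
`t`, `s`, then `t = s`. -/
lemma cube_root_eq_of_derivative_eq {σ : K →+* K} (h2 : (2 : K) = 0) (hσ : ∀ x, σ (σ x) = x)
    (hcube : ∀ z : K, z ^ 3 = 1 → σ z = z ^ 2) {ω lam : K} (hω : ω ^ 2 + ω + 1 = 0)
    (hσlam : σ lam = ω * lam) {a x y t s : K} (ha : a ≠ 0) (ht : t ^ 3 = 1) (hs : s ^ 3 = 1)
    (h : (σ x * x ^ 2 + lam * x) + (σ (x + a * t) * (x + a * t) ^ 2 + lam * (x + a * t)) =
      (σ y * y ^ 2 + lam * y) + (σ (y + a * s) * (y + a * s) ^ 2 + lam * (y + a * s))) :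
    t = s := by
  by_contra hne
  have hσa : σ a ≠ 0 := by simpa using ha
  have hσt := hcube t ht
  have hσs := hcube s hs
  have hts : t ^ 2 + t * s + s ^ 2 = 0 :=
    mul_left_cancel₀ (sub_ne_zero.2 hne) (by linear_combination ht - hs)
  have he : (t + s) ^ 3 = 1 := by grind
  obtain ⟨u, hu⟩ : ∃ u, (t + s) * (t * x + s * y) = a * u :=
    ⟨(t + s) * (t * x + s * y) / a, by field_simp⟩
  have hu' := congrArg σ hu
  simp only [map_add, map_mul, hσt, hσs] at hu'
  simp only [map_add, map_mul, hσt, hσs] at h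
  have hx : t ^ 2 * (σ a * x ^ 2 + a ^ 2 * σ x) + s ^ 2 * (σ a * y ^ 2 + a ^ 2 * σ y) =
      (t + s) * (a * (a * σ a + lam)) := by
    grind
  have hL : σ a * (a * u) ^ 2 + a ^ 2 * (σ a * σ u) = a * (a * σ a + lam) := by
    rw [← hu, ← hu']
    have : t ^ 2 + s ^ 2 = (t + s) ^ 2 := by linear_combination (-(t * s)) * h2
    rw [this]
    linear_combination (t + s) ^ 2 * hx + (a * (a * σ a + lam)) * he +
      (t + s) ^ 2 * t * s * x * y * σ a * h2
  refine mul_sq_add_conj_ne h2 hσ hcube hω hσlam (N := a * σ a) (mul_ne_zero ha hσa)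
    (by rw [map_mul, hσ, mul_comm]) u (mul_left_cancel₀ ha ?_)
  linear_combination hL

/-- In characteristic two, the boomerang connectivity table counts the `x` for which some `c`
satisfies `F(x) + F(x + c) = b` and `F(x + a) + F(x + a + c) = b`. -/
lemma BCT_eq_ncard {F : K → K} (h2 : (2 : K) = 0) (hF : Function.Bijective F) (a b : K) :
    BCT F a b =
      Set.ncard {x : K | ∃ c, F x + F (x + c) = b ∧ F (x + a) + F (x + a + c) = b} := by
  have : Nonempty K := ⟨0⟩
  unfold BCT
  congr 1
  ext x
  simp only [Set.mem_ofPred_eq]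
  have hr : ∀ y, F (Function.invFun F y) = y := Function.rightInverse_invFun hF.2
  have hl : ∀ y, Function.invFun F (F y) = y := Function.leftInverse_invFun hF.1
  constructor
  · intro h
    refine ⟨Function.invFun F (F x + b) - x, ?_, ?_⟩
    · rw [add_sub_cancel, hr]
      linear_combination F x * h2
    · have : x + a + (Function.invFun F (F x + b) - x) =
          Function.invFun F (F (x + a) + b) := by
        linear_combination h + (a - Function.invFun F (F (x + a) + b)) * h2
      rw [this, hr]
      linear_combination F (x + a) * h2
  · rintro ⟨c, h, h'⟩
    have e : F x + b = F (x + c) := by linear_combination -h + F x * h2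
    have e' : F (x + a) + b = F (x + a + c) := by linear_combination -h' + F (x + a) * h2
    rw [e, e', hl, hl]
    linear_combination (x + c) * h2

/-- The four multiples of `a` by roots of `t⁴ = t`, translated by `x`. -/
lemma ncard_translate_le_four (x a ω : K) :
    ({x + a * 0, x + a * 1, x + a * ω, x + a * ω ^ 2} : Set K).ncard ≤ 4 := by
  refine (Set.ncard_insert_le _ _).trans (Nat.succ_le_succ ?_)
  refine (Set.ncard_insert_le _ _).trans (Nat.succ_le_succ ?_)
  refine (Set.ncard_insert_le _ _).trans (Nat.succ_le_succ ?_)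
  simp

lemma binomial_BCT_le_four {σ : K →+* K} (h2 : (2 : K) = 0) (hσ : ∀ x, σ (σ x) = x)
    (hcube : ∀ z : K, z ^ 3 = 1 → σ z = z ^ 2) {ω lam : K} (hω : ω ^ 2 + ω + 1 = 0)
    (hσlam : σ lam = ω * lam)
    (hF : Function.Bijective fun x : K => σ x * x ^ 2 + lam * x)
    {a b : K} (ha : a ≠ 0) (hb : b ≠ 0) :
    BCT (fun x : K => σ x * x ^ 2 + lam * x) a b ≤ 4 := by
  have hω3 : ω ^ 3 = 1 := by linear_combination (ω - 1) * hω
  rw [BCT_eq_ncard h2 hF]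
  set S := {x : K | ∃ c, (σ x * x ^ 2 + lam * x) +
    (σ (x + c) * (x + c) ^ 2 + lam * (x + c)) = b ∧
    (σ (x + a) * (x + a) ^ 2 + lam * (x + a)) +
      (σ (x + a + c) * (x + a + c) ^ 2 + lam * (x + a + c)) = b}
  have key : ∀ x ∈ S, ∃ t, t ^ 3 = 1 ∧ (σ x * x ^ 2 + lam * x) +
      (σ (x + a * t) * (x + a * t) ^ 2 + lam * (x + a * t)) = b := by
    rintro x ⟨c, hc, hc'⟩
    have hpol : σ a * c ^ 2 + a ^ 2 * σ c = 0 := by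
      simp only [map_add] at hc hc'
      grind
    rcases exists_mul_of_polar_eq_zero h2 hσ hω ha hpol with h | h | h | h
    · rw [mul_zero] at h
      subst h
      refine absurd ?_ hb
      rw [← hc, add_zero]
      linear_combination (σ x * x ^ 2 + lam * x) * h2
    · exact ⟨1, one_pow _, h ▸ hc⟩
    · exact ⟨ω, hω3, h ▸ hc⟩
    · exact ⟨ω ^ 2, by linear_combination (ω ^ 3 + 1) * hω3, h ▸ hc⟩
  rcases S.eq_empty_or_nonempty with h | ⟨x, hx⟩
  · rw [h]; simp
  obtain ⟨t, ht, hxt⟩ := key x hx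
  have ht0 : t ≠ 0 := by rintro rfl; simp at ht
  refine (Set.ncard_le_ncard (t := {x + a * 0, x + a * 1, x + a * ω, x + a * ω ^ 2}) ?_
    (Set.toFinite _)).trans (ncard_translate_le_four x a ω)
  intro y hy
  obtain ⟨s, hs, hys⟩ := key y hy
  obtain rfl := cube_root_eq_of_derivative_eq h2 hσ hcube hω hσlam ha ht hs (hxt.trans hys.symm)
  have hpol : σ a * (y - x) ^ 2 + a ^ 2 * σ (y - x) = 0 := by
    have hσt := hcube t ht
    simp only [map_add, map_mul, hσt, map_sub] at hxt hys ⊢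
    refine mul_left_cancel₀ (pow_ne_zero 2 ht0) ?_
    grind
  have hyx : ∀ z, y - x = z → y = x + z := fun z hz => by rw [← hz]; ring
  rcases exists_mul_of_polar_eq_zero h2 hσ hω ha hpol with h | h | h | h <;>
    simp [hyx _ h]

lemma four_le_binomial_BCT [Finite K] {σ : K →+* K} (h2 : (2 : K) = 0)
    (hcube : ∀ z : K, z ^ 3 = 1 → σ z = z ^ 2) {ω lam : K} (hω : ω ^ 2 + ω + 1 = 0)
    (hF : Function.Bijective fun x : K => σ x * x ^ 2 + lam * x) :
    4 ≤ BCT (fun x : K => σ x * x ^ 2 + lam * x) 1 (1 + lam) := by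
  have hω3 : ω ^ 3 = 1 := by linear_combination (ω - 1) * hω
  have hσω := hcube ω hω3
  rw [BCT_eq_ncard h2 hF]
  have hcard : ({0, 1, ω, ω ^ 2} : Set K).ncard = 4 := by
    have h1 : ω ≠ 0 := by rintro rfl; simp at hω3
    have h3 : ω ≠ 1 := by
      rintro rfl
      exact one_ne_zero (by linear_combination hω - h2 : (1 : K) = 0)
    have h4 : ω ^ 2 ≠ 1 := fun h => h3 (by linear_combination hω3 - ω * h)
    have h5 : ω ≠ ω ^ 2 := fun h => h4 (by linear_combination hω3 + ω * h)
    rw [Set.ncard_insert_of_notMem, Set.ncard_insert_of_notMem, Set.ncard_pair h5]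
    · simp [h3.symm, h4.symm]
    · simp [h1.symm, (pow_ne_zero 2 h1).symm]
  rw [← hcard]
  refine Set.ncard_le_ncard ?_ (Set.toFinite _)
  have hmem : ∀ x, σ x = x ^ 2 → x ^ 4 = x → ∃ c, (σ x * x ^ 2 + lam * x) +
      (σ (x + c) * (x + c) ^ 2 + lam * (x + c)) = 1 + lam ∧
      (σ (x + 1) * (x + 1) ^ 2 + lam * (x + 1)) +
        (σ (x + 1 + c) * (x + 1 + c) ^ 2 + lam * (x + 1 + c)) = 1 + lam := by
    intro x hx hx4
    refine ⟨1, ?_, ?_⟩ <;> simp only [map_add, map_one, hx] <;> grind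
  rintro x (rfl | rfl | rfl | rfl) <;> refine hmem _ ?_ ?_
  · simp
  · simp
  · simp
  · simp
  · exact hσω
  · linear_combination x * hω3
  · rw [map_pow, hσω]
  · linear_combination ω ^ 2 * (ω ^ 3 + 1) * hω3

end

theorem binomial_boomerang_four {K : Type*} [Field K] [Fintype K] (m n : ℕ)
    (hm : Odd m) (hm0 : 0 < m) (hn : n = 2 * m) (hcard : Fintype.card K = 2 ^ n)
    (lam : K) (hlam : lam ≠ 0) (horder : orderOf (lam ^ (2 ^ m - 1)) = 3) :
    Function.Bijective (fun x : K => x ^ (2 ^ m + 2) + lam * x) ∧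
      betaU (fun x : K => x ^ (2 ^ m + 2) + lam * x) = 4 := by
  subst hn
  have hchar : CharP K 2 := by
    obtain ⟨p, hp⟩ := CharP.exists K
    obtain ⟨k, hpp, hk⟩ := FiniteField.card K p
    have : p ∣ 2 ^ (2 * m) := by
      rw [← hcard, hk]
      exact dvd_pow_self p k.ne_zero
    obtain rfl := (Nat.prime_dvd_prime_iff_eq hpp Nat.prime_two).1 (hpp.dvd_of_dvd_pow this)
    exact hp
  have h2 : (2 : K) = 0 := CharP.cast_eq_zero K 2
  have : ExpChar K 2 := ExpChar.prime Nat.prime_two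
  set σ : K →+* K := iterateFrobenius K 2 m with hσdef
  have hσx : ∀ x, σ x = x ^ 2 ^ m := fun x => iterateFrobenius_def ..
  have hσ : ∀ x, σ (σ x) = x := fun x => by
    rw [hσx, hσx, ← pow_mul, ← pow_add, ← two_mul, ← hcard, FiniteField.pow_card]
  have hmod : ∃ k, 2 ^ m = 3 * k + 2 := by
    obtain ⟨j, rfl⟩ := hm
    have h : 2 ^ (2 * j + 1) % 3 = 2 := by
      rw [pow_succ, pow_mul, Nat.mul_mod, Nat.pow_mod]
      simp
    refine ⟨2 ^ (2 * j + 1) / 3, ?_⟩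
    conv_lhs => rw [← Nat.div_add_mod (2 ^ (2 * j + 1)) 3, h]
  have hcube : ∀ z : K, z ^ 3 = 1 → σ z = z ^ 2 := fun z hz => by
    obtain ⟨k, hk⟩ := hmod
    rw [hσx, hk, pow_add, pow_mul, hz, one_pow, one_mul]
  set ω := lam ^ (2 ^ m - 1) with hωdef
  have hω3 : ω ^ 3 = 1 := horder ▸ pow_orderOf_eq_one ω
  have hω1 : ω ≠ 1 := fun h => by rw [h, orderOf_one] at horder; omega
  have hω : ω ^ 2 + ω + 1 = 0 :=
    mul_left_cancel₀ (sub_ne_zero.2 hω1) (by linear_combination hω3)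
  have hσlam : σ lam = ω * lam := by
    rw [hσx, hωdef, ← pow_succ, Nat.sub_add_cancel Nat.one_le_two_pow]
  have hFeq : (fun x : K => x ^ (2 ^ m + 2) + lam * x) = fun x => σ x * x ^ 2 + lam * x := by
    funext x
    rw [hσx, pow_add]
  rw [hFeq]
  have hF : Function.Bijective fun x : K => σ x * x ^ 2 + lam * x :=
    Finite.injective_iff_bijective.1 (binomial_injective h2 hσ hcube hω hω1 hlam hσlam)
  refine ⟨hF, le_antisymm (Finset.sup_le ?_) ?_⟩
  · rintro ⟨a, b⟩ hab
    obtain ⟨ha, hb⟩ := (Finset.mem_filter.1 hab).2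
    exact binomial_BCT_le_four h2 hσ hcube hω hσlam hF ha hb
  · have hb : 1 + lam ≠ 0 := fun h => hω1 <| by
      have : lam = 1 := by linear_combination h - h2
      rw [hωdef, this, one_pow]
    refine (four_le_binomial_BCT h2 hcube hω hF).trans ?_
    exact Finset.le_sup (f := fun p : K × K => BCT (fun x : K => σ x * x ^ 2 + lam * x) p.1 p.2)
      (b := (1, 1 + lam)) (by simpa using hb)
end
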